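/- Let μ be a log-concave probability measure on ℝⁿ, let X ∼ μ, let Z be a standard Gaussian random vector in ℝⁿ independent of X, and let f : ℝⁿ → ℝ be smooth, compactly supported and nonconstant. For s > 0 let f_s : ℝⁿ → ℝ denote the conditional-expectation function, f_s(y) = E[f(X) | X + √s·Z = y]. Then the Rayleigh quotient s ↦ E|∇f_s(X + √s·Z)|² / Var(f_s(X + √s·Z)) is non-increasing on (0,∞). -/

import Mathlib

open MeasureTheory ProbabilityTheory Real
open scoped ENNReal NNReal

noncomputable section

/-- Standard Gaussian measure on ℝⁿ. -/
def stdGaussian (n : ℕ) : Measure (EuclideanSpace ℝ (Fin n)) :=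
  volume.withDensity
    (fun x => ENNReal.ofReal ((2 * π) ^ (-(n : ℝ) / 2) * Real.exp (-‖x‖ ^ 2 / 2)))

/-- Heat-flow evolution `μ_s`: the law of `X + √s Z`. -/
def heatFlow {n : ℕ} (μ : Measure (EuclideanSpace ℝ (Fin n))) (s : ℝ) :
    Measure (EuclideanSpace ℝ (Fin n)) :=
  (μ.prod (stdGaussian n)).map (fun p => p.1 + Real.sqrt s • p.2)

/-- Density of the centered Gaussian on ℝⁿ with covariance `s·Id`. -/
def gaussDensity (n : ℕ) (s : ℝ) (x : EuclideanSpace ℝ (Fin n)) : ℝ :=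
  (2 * π * s) ^ (-(n : ℝ) / 2) * Real.exp (-‖x‖ ^ 2 / (2 * s))

/-- Density of `μ_s = μ * γ_s`. -/
def heatDensity {n : ℕ} (μ : Measure (EuclideanSpace ℝ (Fin n))) (s : ℝ)
    (y : EuclideanSpace ℝ (Fin n)) : ℝ :=
  ∫ x, gaussDensity n s (y - x) ∂μ

/-- The conditional-expectation function `f_s(y) = E[f(X) | X + √s Z = y]`, given by the
integral formula `f_s(y) = ∫ γ_s(x−y) f(x) dμ(x) / (ρ * γ_s)(y)`. -/
def condFn {n : ℕ} (μ : Measure (EuclideanSpace ℝ (Fin n)))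
    (f : EuclideanSpace ℝ (Fin n) → ℝ) (s : ℝ) (y : EuclideanSpace ℝ (Fin n)) : ℝ :=
  (∫ x, gaussDensity n s (x - y) * f x ∂μ) / heatDensity μ s y

/-- `μ` is a log-concave probability measure on ℝⁿ: supported on an open convex set,
with density `e^{-H}` there, `H` convex. -/
def IsLogConcave {n : ℕ} (μ : Measure (EuclideanSpace ℝ (Fin n))) : Prop :=
  ∃ (K : Set (EuclideanSpace ℝ (Fin n))) (H : EuclideanSpace ℝ (Fin n) → ℝ),
    IsOpen K ∧ Convex ℝ K ∧ ConvexOn ℝ K H ∧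
    μ = volume.withDensity
      (fun x => Set.indicator K (fun y => ENNReal.ofReal (Real.exp (-H y))) x)

section PrekopaLeindler

open scoped Pointwise in
/-- Midpoint form of the one-dimensional Brunn–Minkowski inequality. -/
lemma volume_add_volume_le_two_mul_volume_of_midpoint {A B M : Set ℝ} (hA : MeasurableSet A)
    (hB : MeasurableSet B) (hA0 : A.Nonempty) (hB0 : B.Nonempty)
    (h : ∀ a ∈ A, ∀ b ∈ B, (a + b) / 2 ∈ M) :
    volume A + volume B ≤ 2 * volume M := by
  have key : ∀ K ⊆ A, IsCompact K → ∀ L ⊆ B, IsCompact L → volume K + volume L ≤ 2 * volume M := by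
    intro K' hK'A hK' L' hL'B hL'
    obtain ⟨a₁, ha₁⟩ := hA0
    obtain ⟨b₁, hb₁⟩ := hB0
    set K := insert a₁ K' with hKdef
    set L := insert b₁ L' with hLdef
    have hK : IsCompact K := hK'.insert a₁
    have hL : IsCompact L := hL'.insert b₁
    have hKA : K ⊆ A := Set.insert_subset ha₁ hK'A
    have hLB : L ⊆ B := Set.insert_subset hb₁ hL'B
    obtain ⟨a, haK, ha⟩ := hK.exists_isGreatest ⟨a₁, Set.mem_insert _ _⟩
    obtain ⟨b, hbL, hb⟩ := hL.exists_isLeast ⟨b₁, Set.mem_insert _ _⟩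
    have himg : ∀ (S : Set ℝ) (c : ℝ), volume S = 2 * volume ((fun x => (2⁻¹ : ℝ) * x + c) '' S) := by
      intro S c
      have : (fun x => (2⁻¹ : ℝ) * x + c) '' S = (fun x => x + c) '' ((2⁻¹ : ℝ) • S) := by
        rw [← Set.image_smul, Set.image_image]; rfl
      rw [this, Set.image_add_right, measure_preimage_add_right, Measure.addHaar_smul]
      simp only [Module.finrank_self, pow_one, ← mul_assoc]
      rw [abs_of_pos (by norm_num), ENNReal.ofReal_inv_of_pos (by norm_num)]
      rw [show ENNReal.ofReal 2 = 2 by simp, ENNReal.mul_inv_cancel (by simp) (by simp), one_mul]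
    set P := (fun x => (2⁻¹ : ℝ) * x + b / 2) '' K
    set Q := (fun x => (2⁻¹ : ℝ) * x + a / 2) '' L
    have hQm : MeasurableSet Q := (hL.image (by fun_prop)).measurableSet
    have hdisj : AEDisjoint volume P Q := by
      refine measure_mono_null (t := {(a + b) / 2}) ?_ (by simp)
      rintro _ ⟨⟨x, hx, rfl⟩, ⟨y, hy, hxy⟩⟩
      have h1 := ha hx
      have h2 := hb hy
      simp only [Set.mem_singleton_iff] at *
      linarith
    have hsub : P ∪ Q ⊆ M := by
      rintro _ (⟨x, hx, rfl⟩ | ⟨x, hx, rfl⟩)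
      · convert h x (hKA hx) b (hLB hbL) using 1; ring
      · convert h a (hKA haK) x (hLB hx) using 1; ring
    calc volume K' + volume L' ≤ volume K + volume L := by
          gcongr <;> exact Set.subset_insert _ _
      _ = 2 * (volume P + volume Q) := by rw [himg K (b / 2), himg L (a / 2), mul_add]
      _ = 2 * volume (P ∪ Q) := by rw [measure_union₀ hQm.nullMeasurableSet hdisj]
      _ ≤ 2 * volume M := by gcongr
  rw [hA.measure_eq_iSup_isCompact, hB.measure_eq_iSup_isCompact]
  simp only [iSup_and']
  exact ENNReal.biSup_add_biSup_le' ⟨∅, Set.empty_subset _, isCompact_empty⟩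
    ⟨∅, Set.empty_subset _, isCompact_empty⟩ fun K hK L hL => key K hK.1 hK.2 L hL.1 hL.2

/-- Layer-cake form of the one-dimensional Prékopa–Leindler inequality for functions with
supremum `1`. -/
lemma lintegral_add_lintegral_le_of_min_le {f g h : ℝ → ℝ≥0∞} (hf : Measurable f)
    (hg : Measurable g) (hh : Measurable h) (hf1 : ⨆ x, f x = 1) (hg1 : ⨆ x, g x = 1)
    (hfg : ∀ x y, min (f x) (g y) ≤ h ((x + y) / 2)) :
    (∫⁻ x, f x) + ∫⁻ x, g x ≤ 2 * ∫⁻ x, h x := by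
  have hfle : ∀ x, f x ≤ 1 := fun x => hf1 ▸ le_iSup f x
  have hgle : ∀ x, g x ≤ 1 := fun x => hg1 ▸ le_iSup g x
  have cake : ∀ {φ : ℝ → ℝ≥0∞}, Measurable φ → (∀ x, φ x ≤ 1) →
      ∫⁻ x, φ x = ∫⁻ t in Set.Ioi (0 : ℝ), volume {x | ENNReal.ofReal t < φ x} := by
    intro φ hφ hφ1
    have hfin : ∀ x, φ x ≠ ∞ := fun x => ((hφ1 x).trans_lt ENNReal.one_lt_top).ne
    have := lintegral_eq_lintegral_meas_lt (f := fun x => (φ x).toReal) volume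
      (Filter.Eventually.of_forall fun x => ENNReal.toReal_nonneg) hφ.ennreal_toReal.aemeasurable
    simp only [ENNReal.ofReal_toReal (hfin _)] at this
    rw [this]
    refine setLIntegral_congr_fun measurableSet_Ioi fun t ht => ?_
    simp only [ENNReal.ofReal_lt_iff_lt_toReal (le_of_lt ht) (hfin _)]
  have hmin : Measurable fun x => min (h x) 1 := hh.min measurable_const
  calc (∫⁻ x, f x) + ∫⁻ x, g x
      = ∫⁻ t in Set.Ioi (0 : ℝ), (volume {x | ENNReal.ofReal t < f x}
          + volume {x | ENNReal.ofReal t < g x}) := by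
        rw [cake hf hfle, cake hg hgle, lintegral_add_left]
        refine Antitone.measurable fun s t hst => measure_mono fun x hx => ?_
        exact (ENNReal.ofReal_le_ofReal hst).trans_lt hx
    _ ≤ ∫⁻ t in Set.Ioi (0 : ℝ), 2 * volume {x | ENNReal.ofReal t < min (h x) 1} := by
        refine setLIntegral_mono' measurableSet_Ioi fun t ht => ?_
        rcases le_or_gt 1 (ENNReal.ofReal t) with h1 | h1
        · have e1 : {x | ENNReal.ofReal t < f x} = ∅ :=
            Set.eq_empty_of_forall_notMem fun x hx => absurd ((hfle x).trans h1) (not_le.2 hx)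
          have e2 : {x | ENNReal.ofReal t < g x} = ∅ :=
            Set.eq_empty_of_forall_notMem fun x hx => absurd ((hgle x).trans h1) (not_le.2 hx)
          simp [e1, e2]
        · refine volume_add_volume_le_two_mul_volume_of_midpoint
            (measurableSet_lt measurable_const hf) (measurableSet_lt measurable_const hg)
            (lt_iSup_iff.1 (h1.trans_eq hf1.symm))
            (lt_iSup_iff.1 (h1.trans_eq hg1.symm)) fun a ha b hb => ?_
          exact lt_min ((lt_min ha hb).trans_le (hfg a b)) h1
    _ = 2 * ∫⁻ x, min (h x) 1 := by
        rw [cake hmin fun x => min_le_right _ _, lintegral_const_mul' _ _ (by simp)]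
    _ ≤ 2 * ∫⁻ x, h x := by
        gcongr
        exact min_le_left _ _

lemma ENNReal.mul_le_sq_of_add_le_two_mul {x y z : ℝ≥0∞} (h : x + y ≤ 2 * z) :
    x * y ≤ z ^ 2 := by
  rcases eq_or_ne z ∞ with rfl | hz
  · simp
  have hxy : x + y < ∞ := h.trans_lt (ENNReal.mul_lt_top (by simp) hz.lt_top)
  lift z to ℝ≥0 using hz
  lift x to ℝ≥0 using (le_self_add.trans_lt hxy).ne
  lift y to ℝ≥0 using (le_add_self.trans_lt hxy).ne
  norm_cast at h ⊢
  have h' : (x : ℝ) + y ≤ 2 * z := by exact_mod_cast h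
  have : (x : ℝ) * y ≤ z ^ 2 := by
    nlinarith [sq_nonneg ((x : ℝ) - y), x.2, y.2, z.2, add_nonneg x.2 y.2]
  exact_mod_cast this

/-- Prékopa–Leindler on the line (midpoint version), for bounded functions. -/
lemma lintegral_mul_lintegral_le_sq_of_bounded {f g h : ℝ → ℝ≥0∞} (hf : Measurable f)
    (hg : Measurable g) (hh : Measurable h) {C : ℝ≥0∞} (hC : C ≠ ∞) (hfC : ∀ x, f x ≤ C)
    (hgC : ∀ x, g x ≤ C) (hfg : ∀ x y, f x * g y ≤ h ((x + y) / 2) ^ 2) :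
    (∫⁻ x, f x) * ∫⁻ x, g x ≤ (∫⁻ x, h x) ^ 2 := by
  set a := ⨆ x, f x with ha
  set b := ⨆ x, g x with hb
  have ha' : a ≠ ∞ := ((iSup_le hfC).trans_lt hC.lt_top).ne
  have hb' : b ≠ ∞ := ((iSup_le hgC).trans_lt hC.lt_top).ne
  rcases eq_or_ne a 0 with h0 | ha0
  · have : ∀ x, f x = 0 := fun x => le_antisymm (h0 ▸ le_iSup f x) zero_le
    simp [this]
  rcases eq_or_ne b 0 with h0 | hb0
  · have : ∀ x, g x = 0 := fun x => le_antisymm (h0 ▸ le_iSup g x) zero_le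
    simp [this]
  obtain ⟨c, hc⟩ : ∃ c : ℝ≥0∞, c ^ 2 = a * b :=
    ⟨(a * b) ^ (1 / 2 : ℝ), by rw [← ENNReal.rpow_natCast, ← ENNReal.rpow_mul]; norm_num⟩
  have hc0 : c ≠ 0 := by rintro rfl; simp [ha0, hb0, eq_comm] at hc
  have hc' : c ≠ ∞ := by
    rintro rfl
    simp only [ne_eq, OfNat.ofNat_ne_zero, not_false_eq_true, ENNReal.top_pow] at hc
    exact ENNReal.mul_ne_top ha' hb' hc.symm
  have key := lintegral_add_lintegral_le_of_min_le (f := fun x => a⁻¹ * f x)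
    (g := fun x => b⁻¹ * g x) (h := fun x => c⁻¹ * h x) (hf.const_mul _) (hg.const_mul _)
    (hh.const_mul _) (by rw [← ENNReal.mul_iSup, ENNReal.inv_mul_cancel ha0 ha'])
    (by rw [← ENNReal.mul_iSup, ENNReal.inv_mul_cancel hb0 hb']) (fun x y => by
      refine (ENNReal.pow_le_pow_left_iff two_ne_zero).1 ?_
      calc min (a⁻¹ * f x) (b⁻¹ * g y) ^ 2 ≤ (a⁻¹ * f x) * (b⁻¹ * g y) := by
            rw [sq]; exact mul_le_mul' (min_le_left _ _) (min_le_right _ _)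
        _ = (a * b)⁻¹ * (f x * g y) := by
            rw [ENNReal.mul_inv (Or.inl ha0) (Or.inl ha')]; ring
        _ ≤ (c ^ 2)⁻¹ * h ((x + y) / 2) ^ 2 := by rw [hc]; gcongr; exact hfg x y
        _ = (c⁻¹ * h ((x + y) / 2)) ^ 2 := by rw [mul_pow, ENNReal.inv_pow])
  rw [lintegral_const_mul _ hf, lintegral_const_mul _ hg, lintegral_const_mul _ hh] at key
  have := ENNReal.mul_le_sq_of_add_le_two_mul key
  calc (∫⁻ x, f x) * ∫⁻ x, g x
      = (a * b) * ((a⁻¹ * ∫⁻ x, f x) * (b⁻¹ * ∫⁻ x, g x)) := by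
        rw [show ∀ p q : ℝ≥0∞, (a * b) * ((a⁻¹ * p) * (b⁻¹ * q)) =
          ((a * a⁻¹) * (b * b⁻¹)) * (p * q) by intros; ring,
          ENNReal.mul_inv_cancel ha0 ha', ENNReal.mul_inv_cancel hb0 hb', one_mul, one_mul]
    _ ≤ c ^ 2 * (c⁻¹ * ∫⁻ x, h x) ^ 2 := by rw [hc]; gcongr
    _ = (∫⁻ x, h x) ^ 2 := by
        rw [← mul_pow, ← mul_assoc, ENNReal.mul_inv_cancel hc0 hc', one_mul]

/-- Prékopa–Leindler on the line (midpoint version). -/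
lemma lintegral_mul_lintegral_le_sq {f g h : ℝ → ℝ≥0∞} (hf : Measurable f)
    (hg : Measurable g) (hh : Measurable h)
    (hfg : ∀ x y, f x * g y ≤ h ((x + y) / 2) ^ 2) :
    (∫⁻ x, f x) * ∫⁻ x, g x ≤ (∫⁻ x, h x) ^ 2 := by
  have trunc : ∀ {φ : ℝ → ℝ≥0∞}, Measurable φ →
      ∫⁻ x, φ x = ⨆ k : ℕ, ∫⁻ x, min (φ x) k := by
    intro φ hφ
    rw [← lintegral_iSup (fun k => hφ.min measurable_const)
      (fun i j hij x => min_le_min_left _ (by exact_mod_cast hij))]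
    refine lintegral_congr fun x => ?_
    rw [← inf_iSup_eq, ENNReal.iSup_natCast, inf_top_eq]
  rw [trunc hf, trunc hg]
  simp only [ENNReal.iSup_mul, ENNReal.mul_iSup, iSup_le_iff]
  intro i j
  refine lintegral_mul_lintegral_le_sq_of_bounded (C := max i j) (hf.min measurable_const)
    (hg.min measurable_const) hh (by simp) (fun x => ?_) (fun x => ?_) fun x y => ?_
  · exact (min_le_right _ _).trans (by simp)
  · exact (min_le_right _ _).trans (by simp)
  · exact (mul_le_mul' (min_le_left _ _) (min_le_left _ _)).trans (hfg x y)

/-- Prékopa–Leindler on `ℝⁿ` (midpoint version). -/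
lemma lintegral_pi_mul_lintegral_pi_le_sq (n : ℕ) : ∀ {f g h : (Fin n → ℝ) → ℝ≥0∞},
    Measurable f → Measurable g → Measurable h →
    (∀ x y, f x * g y ≤ h ((2⁻¹ : ℝ) • (x + y)) ^ 2) →
    (∫⁻ x, f x) * ∫⁻ x, g x ≤ (∫⁻ x, h x) ^ 2 := by
  induction n with
  | zero =>
    intro f g h hf hg hh hfg
    rw [Measure.volume_pi_eq_dirac, lintegral_dirac, lintegral_dirac, lintegral_dirac]
    convert hfg _ _
  | succ n ih =>
    intro f g h hf hg hh hfg
    let e := (MeasurableEquiv.piFinSuccAbove (fun _ : Fin (n + 1) => ℝ) 0).symm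
    have he : MeasurePreserving e volume volume :=
      (volume_preserving_piFinSuccAbove (fun _ : Fin (n + 1) => ℝ) 0).symm _
    have slice : ∀ {φ : (Fin (n + 1) → ℝ) → ℝ≥0∞}, Measurable φ →
        ∫⁻ x, φ x = ∫⁻ t, ∫⁻ z, φ (e (t, z)) := by
      intro φ hφ
      rw [← he.lintegral_comp hφ, Measure.volume_eq_prod,
        lintegral_prod (fun p => φ (e p)) (hφ.comp e.measurable).aemeasurable]
    have hmeas : ∀ {φ : (Fin (n + 1) → ℝ) → ℝ≥0∞}, Measurable φ →
        Measurable fun t => ∫⁻ z, φ (e (t, z)) := fun hφ =>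
      (hφ.comp e.measurable).lintegral_prod_right'
    have hsl : ∀ {φ : (Fin (n + 1) → ℝ) → ℝ≥0∞}, Measurable φ → ∀ t,
        Measurable fun z => φ (e (t, z)) := fun hφ t =>
      hφ.comp (e.measurable.comp measurable_prodMk_left)
    rw [slice hf, slice hg, slice hh]
    refine lintegral_mul_lintegral_le_sq (hmeas hf) (hmeas hg) (hmeas hh) fun s t => ?_
    refine ih (hsl hf s) (hsl hg t) (hsl hh _) fun x y => ?_
    convert hfg (e (s, x)) (e (t, y)) using 3
    ext i
    refine Fin.cases ?_ (fun j => ?_) i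
    · simp [e, MeasurableEquiv.piFinSuccAbove, div_eq_inv_mul]
    · simp [e, MeasurableEquiv.piFinSuccAbove, mul_add]

/-- Prékopa–Leindler on Euclidean space (midpoint version). -/
lemma lintegral_euclidean_mul_lintegral_le_sq {n : ℕ} {f g h : EuclideanSpace ℝ (Fin n) → ℝ≥0∞}
    (hf : Measurable f) (hg : Measurable g) (hh : Measurable h)
    (hfg : ∀ x y, f x * g y ≤ h ((2⁻¹ : ℝ) • (x + y)) ^ 2) :
    (∫⁻ x, f x) * ∫⁻ x, g x ≤ (∫⁻ x, h x) ^ 2 := by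
  have he := PiLp.volume_preserving_toLp (Fin n)
  have hm := WithLp.measurable_toLp 2 (Fin n → ℝ)
  rw [← he.lintegral_comp hf, ← he.lintegral_comp hg, ← he.lintegral_comp hh]
  refine lintegral_pi_mul_lintegral_pi_le_sq n (hf.comp hm) (hg.comp hm) (hh.comp hm) fun x y => ?_
  simpa using hfg (WithLp.toLp 2 x) (WithLp.toLp 2 y)

end PrekopaLeindler

section HeatKernel

variable {n : ℕ}

/-- `heatHermite k s` is the polynomial with `∂ₜᵏ g = heatHermite k s · g` for the one-dimensional
heat kernel `g` at time `s`. -/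
def heatHermite : ℕ → ℝ → ℝ → ℝ
  | 0, _, _ => 1
  | 1, s, t => -(t / s)
  | k + 2, s, t => -(t * heatHermite (k + 1) s t + (k + 1) * heatHermite k s t) / s

/-- The `k`-th space derivative of the one-dimensional heat kernel at time `s`. -/
def heatKernel (k : ℕ) (s t : ℝ) : ℝ :=
  heatHermite k s t * ((2 * π * s) ^ (-(1 : ℝ) / 2) * Real.exp (-t ^ 2 / (2 * s)))

lemma heatHermite_succ_succ (k : ℕ) (s t : ℝ) : heatHermite (k + 2) s t =
    -(t * heatHermite (k + 1) s t + (k + 1) * heatHermite k s t) / s := by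
  rw [heatHermite]

lemma heatHermite_succ (k : ℕ) (s t : ℝ) : heatHermite (k + 1) s t =
    -(t * heatHermite k s t + k * heatHermite (k - 1) s t) / s := by
  rcases k with _ | k
  · simp [heatHermite, neg_div]
  · rw [heatHermite_succ_succ]; simp

lemma hasDerivAt_heatHermite (s t : ℝ) : ∀ k : ℕ,
    HasDerivAt (heatHermite k s) (-(k * heatHermite (k - 1) s t) / s) t := by
  intro k
  induction k using Nat.strong_induction_on with
  | _ k ih =>
    rcases k with _ | _ | k
    · simpa [heatHermite] using hasDerivAt_const t (1 : ℝ)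
    · have := ((hasDerivAt_id t).div_const s).neg
      refine (this.congr_deriv ?_).congr_of_eventuallyEq (Filter.Eventually.of_forall fun x => ?_)
      · simp [heatHermite, neg_div]
      · simp [heatHermite]
    · have h1 := ih (k + 1) (by omega)
      have h0 := ih k (by omega)
      have := ((((hasDerivAt_id t).mul h1).add (h0.const_mul ((k : ℝ) + 1))).neg).div_const s
      refine (this.congr_deriv ?_).congr_of_eventuallyEq (Filter.Eventually.of_forall fun x => ?_)
      · have e := heatHermite_succ k s t
        simp only [Nat.add_sub_cancel, id, show k + 1 + 1 - 1 = k + 1 by omega]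
        rw [e]
        push_cast
        ring
      · simp [heatHermite]

lemma hasDerivAt_heatHermite_time {s : ℝ} (hs : s ≠ 0) (t : ℝ) : ∀ k : ℕ,
    HasDerivAt (fun s => heatHermite k s t)
      (2⁻¹ * (heatHermite (k + 2) s t - heatHermite k s t * heatHermite 2 s t)) s := by
  intro k
  induction k using Nat.strong_induction_on with
  | _ k ih =>
    rcases k with _ | _ | k
    · simpa [heatHermite] using hasDerivAt_const s (1 : ℝ)
    · have := ((hasDerivAt_const s t).div (hasDerivAt_id s) hs).neg
      refine (this.congr_deriv ?_).congr_of_eventuallyEq (Filter.Eventually.of_forall fun x => ?_)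
      · simp [heatHermite]; field_simp; ring
      · simp [heatHermite]
    · have h1 := ih (k + 1) (by omega)
      have h0 := ih k (by omega)
      have := ((((h1.const_mul t).add (h0.const_mul ((k : ℝ) + 1))).neg).div (hasDerivAt_id s) hs)
      refine (this.congr_deriv ?_).congr_of_eventuallyEq (Filter.Eventually.of_forall fun x => ?_)
      · rw [show k + 1 + 1 + 2 = k + 2 + 2 by omega, show k + 1 + 2 = k + 1 + 2 by omega,
          show k + 1 + 1 = k + 2 by omega]
        rw [heatHermite_succ_succ (k + 2), heatHermite_succ_succ (k + 1),
          show k + 1 + 1 = k + 2 by omega, heatHermite_succ_succ k]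
        simp [heatHermite]
        field_simp
        ring
      · simp [heatHermite]

lemma hasDerivAt_heatKernel (k : ℕ) (s t : ℝ) :
    HasDerivAt (heatKernel k s) (heatKernel (k + 1) s t) t := by
  have hexp : HasDerivAt (fun t : ℝ => Real.exp (-t ^ 2 / (2 * s)))
      (Real.exp (-t ^ 2 / (2 * s)) * (-(t / s))) t := by
    have := (((hasDerivAt_id t).pow 2).neg.div_const (2 * s)).exp
    refine this.congr_deriv ?_
    simp
    rcases eq_or_ne s 0 with rfl | hs
    · simp
    · field_simp
  refine ((hasDerivAt_heatHermite s t k).mul (hexp.const_mul _)).congr_deriv ?_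
  rw [heatKernel, heatHermite_succ]
  ring

lemma hasDerivAt_heatKernel_time (k : ℕ) {s : ℝ} (hs : 0 < s) (t : ℝ) :
    HasDerivAt (fun s => heatKernel k s t) (2⁻¹ * heatKernel (k + 2) s t) s := by
  have hexp : HasDerivAt (fun s : ℝ => Real.exp (-t ^ 2 / (2 * s)))
      (Real.exp (-t ^ 2 / (2 * s)) * (t ^ 2 / (2 * s ^ 2))) s := by
    have := ((hasDerivAt_const s (-t ^ 2)).div ((hasDerivAt_id s).const_mul 2)
      (by simpa using hs.ne')).exp
    refine this.congr_deriv ?_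
    simp
    field_simp
  have hpow : HasDerivAt (fun s : ℝ => (2 * π * s) ^ (-(1 : ℝ) / 2))
      ((2 * π * s) ^ (-(1 : ℝ) / 2) * (-(1 / (2 * s)))) s := by
    have hp : (2 * π * s) ≠ 0 := by positivity
    have := ((hasDerivAt_id s).const_mul (2 * π)).rpow_const (p := -(1 : ℝ) / 2) (Or.inl hp)
    refine this.congr_deriv ?_
    rw [Real.rpow_sub_one (by simpa using hs.ne')]
    simp
    field_simp
  refine ((hasDerivAt_heatHermite_time hs.ne' t k).mul (hpow.mul hexp)).congr_deriv ?_
  simp only [heatKernel, Pi.mul_apply]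
  have : heatHermite 2 s t = t ^ 2 / s ^ 2 - 1 / s := by
    simp [heatHermite]; field_simp; ring
  rw [this]
  field_simp
  ring

lemma abs_heatHermite_le {a : ℝ} (ha : 0 < a) : ∀ k : ℕ, ∃ C, 0 ≤ C ∧ ∀ s, a ≤ s → ∀ t,
    |heatHermite k s t| ≤ C * Real.exp (k * |t|) := by
  intro k
  induction k using Nat.strong_induction_on with
  | _ k ih =>
    rcases k with _ | _ | k
    · exact ⟨1, zero_le_one, fun s hs t => by simp [heatHermite]⟩
    · refine ⟨a⁻¹, by positivity, fun s hs t => ?_⟩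
      have hs0 : 0 < s := ha.trans_le hs
      have h1 : |t| ≤ Real.exp |t| := by linarith [Real.add_one_le_exp |t|]
      simp only [heatHermite, abs_neg, abs_div, abs_of_pos hs0, zero_add, Nat.cast_one, one_mul]
      rw [div_eq_inv_mul]
      gcongr
    · obtain ⟨C₁, hC₁, h₁⟩ := ih (k + 1) (by omega)
      obtain ⟨C₀, hC₀, h₀⟩ := ih k (by omega)
      refine ⟨a⁻¹ * (C₁ + (k + 1) * C₀), by positivity, fun s hs t => ?_⟩
      have hs0 : 0 < s := ha.trans_le hs
      have h1 : |t| ≤ Real.exp |t| := by linarith [Real.add_one_le_exp |t|]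
      have e1 : |t| * |heatHermite (k + 1) s t| ≤ C₁ * Real.exp (((k + 2 : ℕ) : ℝ) * |t|) := by
        calc |t| * |heatHermite (k + 1) s t|
            ≤ Real.exp |t| * (C₁ * Real.exp (((k + 1 : ℕ) : ℝ) * |t|)) := by
              gcongr; exact h₁ s hs t
          _ = _ := by
              rw [mul_left_comm, ← Real.exp_add]; congr 2; push_cast; ring
      have e0 : |heatHermite k s t| ≤ C₀ * Real.exp (((k + 2 : ℕ) : ℝ) * |t|) := by
        refine (h₀ s hs t).trans ?_
        gcongr
        omega
      rw [heatHermite_succ_succ, abs_div, abs_neg, abs_of_pos hs0, div_eq_inv_mul, mul_assoc]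
      gcongr
      calc |t * heatHermite (k + 1) s t + (k + 1) * heatHermite k s t|
          ≤ |t| * |heatHermite (k + 1) s t| + (k + 1) * |heatHermite k s t| := by
            refine (abs_add_le _ _).trans ?_
            rw [abs_mul, abs_mul, abs_of_nonneg (by positivity : (0 : ℝ) ≤ (k : ℝ) + 1)]
        _ ≤ C₁ * Real.exp (((k + 2 : ℕ) : ℝ) * |t|)
            + (k + 1) * (C₀ * Real.exp (((k + 2 : ℕ) : ℝ) * |t|)) := by gcongr
        _ = _ := by ring

lemma heatKernel_zero (s t : ℝ) :
    heatKernel 0 s t = (2 * π * s) ^ (-(1 : ℝ) / 2) * Real.exp (-t ^ 2 / (2 * s)) := by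
  simp [heatKernel, heatHermite]

/-- Bound of the derivatives of the heat kernel by the kernel with an exponential weight. -/
lemma abs_heatKernel_le {a : ℝ} (ha : 0 < a) (k : ℕ) : ∃ C, 0 ≤ C ∧ ∀ s, a ≤ s → ∀ t,
    |heatKernel k s t| ≤ C * (Real.exp (k * |t|) * heatKernel 0 s t) := by
  obtain ⟨C, hC, h⟩ := abs_heatHermite_le ha k
  refine ⟨C, hC, fun s hs t => ?_⟩
  have hs0 : 0 < s := ha.trans_le hs
  rw [heatKernel_zero, heatKernel, abs_mul, ← mul_assoc]
  rw [abs_of_nonneg (a := _ * Real.exp _) (by positivity)]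
  gcongr
  exact h s hs t

/-- Exponential weights are absorbed by the Gaussian, uniformly for `s ∈ [a, b]`. -/
lemma exp_mul_heatKernel_zero_le {a : ℝ} (ha : 0 < a) (b : ℝ) (m : ℕ) :
    ∃ C, 0 ≤ C ∧ ∀ s ∈ Set.Icc a b, ∀ t,
      Real.exp (m * |t|) * heatKernel 0 s t ≤ C * Real.exp (-(1 / (4 * b)) * t ^ 2) := by
  refine ⟨(2 * π * a) ^ (-(1 : ℝ) / 2) * Real.exp (m ^ 2 * b), by positivity, fun s hs t => ?_⟩
  have hs0 : 0 < s := ha.trans_le hs.1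
  have hb0 : 0 < b := hs0.trans_le hs.2
  have h1 : (2 * π * s) ^ (-(1 : ℝ) / 2) ≤ (2 * π * a) ^ (-(1 : ℝ) / 2) :=
    Real.rpow_le_rpow_of_nonpos (by positivity)
      (mul_le_mul_of_nonneg_left hs.1 (by positivity)) (by norm_num)
  have h2 : m * |t| + -t ^ 2 / (2 * s) ≤ m ^ 2 * b + -(1 / (4 * b)) * t ^ 2 := by
    have e1 : -t ^ 2 / (2 * s) ≤ -t ^ 2 / (2 * b) := by
      rw [neg_div, neg_div, neg_le_neg_iff]
      have := hs.2
      gcongr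
    have e2 : 0 ≤ (2 * b * m - |t|) ^ 2 / (4 * b) := by positivity
    have e3 : (2 * b * m - |t|) ^ 2 / (4 * b) = m ^ 2 * b - m * |t| + 1 / (4 * b) * t ^ 2 := by
      rw [sub_sq, sq_abs]; field_simp; ring
    have e4 : -t ^ 2 / (2 * b) = - 2 * (1 / (4 * b) * t ^ 2) := by field_simp; ring
    linarith
  calc Real.exp (m * |t|) * heatKernel 0 s t
      = (2 * π * s) ^ (-(1 : ℝ) / 2) * Real.exp (m * |t| + -t ^ 2 / (2 * s)) := by
        rw [heatKernel_zero, Real.exp_add]; ring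
    _ ≤ (2 * π * a) ^ (-(1 : ℝ) / 2) * Real.exp (m ^ 2 * b + -(1 / (4 * b)) * t ^ 2) := by
        gcongr
    _ = _ := by rw [Real.exp_add]; ring


/-- The `α`-th space derivative of the heat kernel on `ℝⁿ` at time `s`. -/
def heatKernelN (α : Fin n → ℕ) (s : ℝ) (z : EuclideanSpace ℝ (Fin n)) : ℝ :=
  ∏ i, heatKernel (α i) s (z i)

/-- The weight `exp(|z₁| + ⋯ + |zₙ|)`. -/
def expWeight (z : EuclideanSpace ℝ (Fin n)) : ℝ := ∏ i, Real.exp |z i|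

lemma gaussDensity_eq_heatKernelN {s : ℝ} (hs : 0 < s) (z : EuclideanSpace ℝ (Fin n)) :
    gaussDensity n s z = heatKernelN 0 s z := by
  simp only [gaussDensity, heatKernelN, Pi.zero_apply, heatKernel_zero, Finset.prod_mul_distrib,
    ← Real.exp_sum, Finset.prod_const, Finset.card_univ, Fintype.card_fin]
  congr 1
  · rw [← Real.rpow_natCast, ← Real.rpow_mul (by positivity)]
    congr 1; ring
  · rw [EuclideanSpace.norm_sq_eq, ← Finset.sum_div, Finset.sum_neg_distrib]
    simp

lemma hasFDerivAt_heatKernelN (α : Fin n → ℕ) (s : ℝ) (z : EuclideanSpace ℝ (Fin n)) :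
    HasFDerivAt (heatKernelN α s) (∑ i, heatKernelN (α + Pi.single i 1) s z •
      (EuclideanSpace.proj i : EuclideanSpace ℝ (Fin n) →L[ℝ] ℝ)) z := by
  have h := HasFDerivAt.finsetProd (u := Finset.univ)
    (g := fun i (z : EuclideanSpace ℝ (Fin n)) => heatKernel (α i) s (z i)) (x := z)
    (g' := fun i => heatKernel (α i + 1) s (z i) • EuclideanSpace.proj i) (fun i _ =>
      HasDerivAt.comp_hasFDerivAt (h₂ := heatKernel (α i) s) z
        (hasDerivAt_heatKernel (α i) s (z i))
        (EuclideanSpace.proj i : EuclideanSpace ℝ (Fin n) →L[ℝ] ℝ).hasFDerivAt)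
  refine h.congr_fderiv (Finset.sum_congr rfl fun i _ => ?_)
  rw [smul_smul]
  congr 1
  rw [heatKernelN, ← Finset.mul_prod_erase _ _ (Finset.mem_univ i), mul_comm]
  congr 1
  · simp
  · refine Finset.prod_congr rfl fun j hj => ?_
    simp [Pi.single_eq_of_ne (Finset.ne_of_mem_erase hj)]

lemma hasDerivAt_heatKernelN_time (α : Fin n → ℕ) {s : ℝ} (hs : 0 < s)
    (z : EuclideanSpace ℝ (Fin n)) :
    HasDerivAt (fun s => heatKernelN α s z)
      (∑ i, 2⁻¹ * heatKernelN (α + Pi.single i 1 + Pi.single i 1) s z) s := by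
  have h := HasDerivAt.fun_finsetProd (u := Finset.univ)
    (f := fun i s => heatKernel (α i) s (z i)) (x := s)
    (f' := fun i => 2⁻¹ * heatKernel (α i + 2) s (z i)) (fun i _ =>
      hasDerivAt_heatKernel_time (α i) hs (z i))
  refine h.congr_deriv (Finset.sum_congr rfl fun i _ => ?_)
  rw [heatKernelN, ← Finset.mul_prod_erase _ _ (Finset.mem_univ i), smul_eq_mul]
  rw [mul_comm, mul_assoc]
  congr 1
  congr 1
  · simp [add_assoc]
  · refine Finset.prod_congr rfl fun j hj => ?_
    simp [Pi.single_eq_of_ne (Finset.ne_of_mem_erase hj)]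

lemma one_le_expWeight (z : EuclideanSpace ℝ (Fin n)) : 1 ≤ expWeight z :=
  Finset.one_le_prod fun _ _ => Real.one_le_exp (abs_nonneg _)

lemma heatKernelN_zero_pos {s : ℝ} (hs : 0 < s) (z : EuclideanSpace ℝ (Fin n)) :
    0 < heatKernelN 0 s z := by
  refine Finset.prod_pos fun i _ => ?_
  rw [Pi.zero_apply, heatKernel_zero]
  positivity

lemma abs_heatKernelN_le {a : ℝ} (ha : 0 < a) (α : Fin n → ℕ) : ∃ C m, 0 ≤ C ∧ ∀ s, a ≤ s →
    ∀ z, |heatKernelN α s z| ≤ C * (expWeight z ^ (m : ℕ) * heatKernelN 0 s z) := by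
  choose C hC h using fun i => abs_heatKernel_le ha (α i)
  refine ⟨∏ i, C i, ∑ i, α i, Finset.prod_nonneg fun i _ => hC i, fun s hs z => ?_⟩
  have hs0 : 0 < s := ha.trans_le hs
  rw [heatKernelN, Finset.abs_prod, heatKernelN, expWeight, ← Finset.prod_pow,
    ← Finset.prod_mul_distrib, ← Finset.prod_mul_distrib]
  refine Finset.prod_le_prod (fun _ _ => abs_nonneg _) fun i _ => (h i s hs (z i)).trans ?_
  have hp : 0 ≤ heatKernel 0 s (z i) := by rw [heatKernel_zero]; positivity
  have := hC i
  rw [← Real.exp_nat_mul]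
  simp only [Pi.zero_apply]
  gcongr
  exact Finset.single_le_sum (f := α) (fun _ _ => Nat.zero_le _) (Finset.mem_univ i)

lemma expWeight_pow_mul_heatKernelN_le {a : ℝ} (ha : 0 < a) (b : ℝ) (m : ℕ) :
    ∃ C, 0 ≤ C ∧ ∀ s ∈ Set.Icc a b, ∀ z : EuclideanSpace ℝ (Fin n),
      expWeight z ^ m * heatKernelN 0 s z ≤ C * Real.exp (-(1 / (4 * b)) * ‖z‖ ^ 2) := by
  obtain ⟨C, hC, h⟩ := exp_mul_heatKernel_zero_le ha b m
  refine ⟨C ^ n, by positivity, fun s hs z => ?_⟩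
  have hs0 : 0 < s := ha.trans_le hs.1
  rw [heatKernelN, expWeight, ← Finset.prod_pow, ← Finset.prod_mul_distrib,
    EuclideanSpace.norm_sq_eq, Finset.mul_sum, Real.exp_sum]
  have : C ^ n = ∏ _i : Fin n, C := by simp
  rw [this, ← Finset.prod_mul_distrib]
  refine Finset.prod_le_prod (fun i _ => ?_) fun i _ => ?_
  · rw [Pi.zero_apply, heatKernel_zero]; positivity
  · rw [← Real.exp_nat_mul]
    simpa using h s hs (z i)

end HeatKernel

section HeatMoment

variable {n : ℕ}

lemma exists_bound_heatKernelN {a b : ℝ} (ha : 0 < a) (hab : a ≤ b) (α : Fin n → ℕ) :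
    ∃ C, ∀ s ∈ Set.Icc a b, ∀ z, |heatKernelN α s z| ≤ C := by
  obtain ⟨C₁, m, hC₁, h₁⟩ := abs_heatKernelN_le ha α
  obtain ⟨C₂, hC₂, h₂⟩ := expWeight_pow_mul_heatKernelN_le (n := n) ha b m
  have hb : 0 < b := ha.trans_le hab
  refine ⟨C₁ * C₂, fun s hs z => (h₁ s hs.1 z).trans ?_⟩
  gcongr
  refine (h₂ s hs z).trans (mul_le_of_le_one_right hC₂ (Real.exp_le_one_iff.2 ?_))
  rw [neg_mul, Left.neg_nonpos_iff]
  positivity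

lemma continuous_heatKernelN (α : Fin n → ℕ) (s : ℝ) : Continuous (heatKernelN α s) :=
  continuous_iff_continuousAt.2 fun z => (hasFDerivAt_heatKernelN α s z).continuousAt

/-- The integral `∫ w(x) ∂^α γ_s(y - x) dμ(x)`. -/
def heatMoment (μ : Measure (EuclideanSpace ℝ (Fin n))) (w : EuclideanSpace ℝ (Fin n) → ℝ)
    (α : Fin n → ℕ) (s : ℝ) (y : EuclideanSpace ℝ (Fin n)) : ℝ :=
  ∫ x, w x * heatKernelN α s (y - x) ∂μ

section Moment

variable {μ : Measure (EuclideanSpace ℝ (Fin n))} [IsProbabilityMeasure μ]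
  {w : EuclideanSpace ℝ (Fin n) → ℝ} {M : ℝ}

lemma integrable_heatMoment (hw : Measurable w) (hM : ∀ x, |w x| ≤ M) (α : Fin n → ℕ) {s : ℝ}
    (hs : 0 < s) (y : EuclideanSpace ℝ (Fin n)) :
    Integrable (fun x => w x * heatKernelN α s (y - x)) μ := by
  obtain ⟨C, hC⟩ := exists_bound_heatKernelN (n := n) hs le_rfl α
  have hk : Measurable fun x => heatKernelN α s (y - x) :=
    ((continuous_heatKernelN α s).comp (by fun_prop)).measurable
  refine Integrable.of_bound (hw.mul hk).aestronglyMeasurable (M * C)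
    (Filter.Eventually.of_forall fun x => ?_)
  rw [Real.norm_eq_abs, abs_mul]
  exact mul_le_mul (hM x) (hC s ⟨le_rfl, le_rfl⟩ _) (abs_nonneg _) ((abs_nonneg _).trans (hM x))

lemma hasFDerivAt_heatMoment (hw : Measurable w) (hM : ∀ x, |w x| ≤ M) (α : Fin n → ℕ) {s : ℝ}
    (hs : 0 < s) (y : EuclideanSpace ℝ (Fin n)) :
    HasFDerivAt (heatMoment μ w α s) (∑ i, heatMoment μ w (α + Pi.single i 1) s y •
      (EuclideanSpace.proj i : EuclideanSpace ℝ (Fin n) →L[ℝ] ℝ)) y := by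
  choose C hC using fun i => exists_bound_heatKernelN (n := n) hs le_rfl (α + Pi.single i 1)
  let p : Fin n → EuclideanSpace ℝ (Fin n) →L[ℝ] ℝ := fun i => EuclideanSpace.proj i
  let F' : EuclideanSpace ℝ (Fin n) → EuclideanSpace ℝ (Fin n) →
      EuclideanSpace ℝ (Fin n) →L[ℝ] ℝ :=
    fun y x => ∑ i, (w x * heatKernelN (α + Pi.single i 1) s (y - x)) • p i
  have hint := fun i => integrable_heatMoment (μ := μ) hw hM (α + Pi.single i 1) hs y
  have hmeas : AEStronglyMeasurable (F' y) μ :=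
    Finset.aestronglyMeasurable_fun_sum _ fun i _ => (hint i).aestronglyMeasurable.smul_const _
  have hbound : ∀ x y, ‖F' y x‖ ≤ ∑ i, M * C i * ‖p i‖ := fun x y => by
    refine (norm_sum_le _ _).trans (Finset.sum_le_sum fun i _ => ?_)
    rw [norm_smul, Real.norm_eq_abs, abs_mul]
    gcongr
    · exact (abs_nonneg _).trans (hM x)
    · exact hM x
    · exact hC i s ⟨le_rfl, le_rfl⟩ _
  have hderiv : ∀ x y, HasFDerivAt (fun y => w x * heatKernelN α s (y - x)) (F' y x) y :=
    fun x y => by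
      have := ((hasFDerivAt_heatKernelN α s (y - x)).comp y
        ((hasFDerivAt_id y).sub_const x)).const_mul (w x)
      refine this.congr_fderiv ?_
      rw [ContinuousLinearMap.comp_id, Finset.smul_sum]
      simp only [smul_smul, p, F']
  have h := hasFDerivAt_integral_of_dominated_of_fderiv_le (𝕜 := ℝ) (μ := μ) (s := Set.univ)
    (bound := fun _ => ∑ i, M * C i * ‖p i‖) Filter.univ_mem
    (Filter.Eventually.of_forall fun y =>
      (integrable_heatMoment hw hM α hs y).aestronglyMeasurable)
    (integrable_heatMoment hw hM α hs y) hmeas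
    (Filter.Eventually.of_forall fun x y _ => hbound x y)
    (integrable_const _)
    (Filter.Eventually.of_forall fun x y _ => hderiv x y)
  refine h.congr_fderiv ?_
  simp only [F']
  rw [integral_finsetSum _ fun i _ => (hint i).smul_const (p i)]
  exact Finset.sum_congr rfl fun i _ => integral_smul_const _ _

lemma hasDerivAt_heatMoment_time (hw : Measurable w) (hM : ∀ x, |w x| ≤ M) (α : Fin n → ℕ)
    {s : ℝ} (hs : 0 < s) (y : EuclideanSpace ℝ (Fin n)) :
    HasDerivAt (fun s => heatMoment μ w α s y)
      (∑ i, 2⁻¹ * heatMoment μ w (α + Pi.single i 1 + Pi.single i 1) s y) s := by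
  have hs2 : 0 < s / 2 := by positivity
  choose C hC using fun i => exists_bound_heatKernelN (n := n) hs2 (by linarith : s / 2 ≤ 2 * s)
    (α + Pi.single i 1 + Pi.single i 1)
  have hint := fun i => integrable_heatMoment (μ := μ) hw hM (α + Pi.single i 1 + Pi.single i 1) hs y
  let F' : ℝ → EuclideanSpace ℝ (Fin n) → ℝ := fun s x =>
    ∑ i, 2⁻¹ * (w x * heatKernelN (α + Pi.single i 1 + Pi.single i 1) s (y - x))
  have hmeas : AEStronglyMeasurable (F' s) μ :=
    Finset.aestronglyMeasurable_fun_sum _ fun i _ => ((hint i).const_mul _).aestronglyMeasurable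
  have hbound : ∀ x, ∀ s' ∈ Set.Icc (s / 2) (2 * s), ‖F' s' x‖ ≤ ∑ i, 2⁻¹ * (M * C i) :=
    fun x s' hs' => by
      refine (norm_sum_le _ _).trans (Finset.sum_le_sum fun i _ => ?_)
      rw [Real.norm_eq_abs, abs_mul, abs_mul, abs_of_pos (by norm_num : (0 : ℝ) < 2⁻¹)]
      gcongr
      · exact (abs_nonneg _).trans (hM x)
      · exact hM x
      · exact hC i s' hs' _
  have hderiv : ∀ x, ∀ s' ∈ Set.Icc (s / 2) (2 * s),
      HasDerivAt (fun s => w x * heatKernelN α s (y - x)) (F' s' x) s' := fun x s' hs' => by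
    have := (hasDerivAt_heatKernelN_time α (hs2.trans_le hs'.1) (y - x)).const_mul (w x)
    refine this.congr_deriv ?_
    rw [Finset.mul_sum]
    exact Finset.sum_congr rfl fun i _ => by ring
  have h := hasDerivAt_integral_of_dominated_loc_of_deriv_le (𝕜 := ℝ) (μ := μ)
    (bound := fun _ => ∑ i, 2⁻¹ * (M * C i))
    (Icc_mem_nhds (by linarith : s / 2 < s) (by linarith : s < 2 * s))
    (Filter.eventually_of_mem (Ioi_mem_nhds hs) fun s hs =>
      (integrable_heatMoment hw hM α hs y).aestronglyMeasurable)
    (integrable_heatMoment hw hM α hs y) hmeas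
    (Filter.Eventually.of_forall hbound) (integrable_const _)
    (Filter.Eventually.of_forall hderiv)
  refine h.2.congr_deriv ?_
  simp only [F']
  rw [integral_finsetSum _ fun i _ => (hint i).const_mul _]
  exact Finset.sum_congr rfl fun i _ => integral_const_mul _ _

lemma heatMoment_one_zero_pos {s : ℝ} (hs : 0 < s) (y : EuclideanSpace ℝ (Fin n)) :
    0 < heatMoment μ 1 0 s y := by
  have hint := integrable_heatMoment (μ := μ) (w := 1) measurable_one (M := 1) (by simp) 0 hs y
  rw [heatMoment, integral_pos_iff_support_of_nonneg (fun x => ?_) hint]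
  · have : (Function.support fun x => (1 : EuclideanSpace ℝ (Fin n) → ℝ) x
        * heatKernelN 0 s (y - x)) = Set.univ := by
      ext x; simp [(heatKernelN_zero_pos hs _).ne']
    rw [this]
    simp
  · simpa using (heatKernelN_zero_pos hs _).le

lemma heatDensity_eq_heatMoment {μ : Measure (EuclideanSpace ℝ (Fin n))} {s : ℝ} (hs : 0 < s) (y : EuclideanSpace ℝ (Fin n)) :
    heatDensity μ s y = heatMoment μ 1 0 s y := by
  simp [heatDensity, heatMoment, gaussDensity_eq_heatKernelN hs]

/-- The integral `∫ exp(m |y - x|₁) γ_s(y - x) dμ(x)`. -/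
def expMoment (μ : Measure (EuclideanSpace ℝ (Fin n))) (m : ℕ) (s : ℝ)
    (y : EuclideanSpace ℝ (Fin n)) : ℝ :=
  ∫ x, expWeight (y - x) ^ m * heatKernelN 0 s (y - x) ∂μ

/-- The convolution of `μ` with the Gaussian profile `exp(-‖z‖² / (4 * b))`. -/
def gaussEnvelope (μ : Measure (EuclideanSpace ℝ (Fin n))) (b : ℝ)
    (y : EuclideanSpace ℝ (Fin n)) : ℝ :=
  ∫ x, Real.exp (-(1 / (4 * b)) * ‖y - x‖ ^ 2) ∂μ

lemma continuous_expWeight : Continuous (expWeight (n := n)) := by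
  unfold expWeight; fun_prop

lemma integrable_gaussEnvelope_section {b : ℝ} (hb : 0 < b) (y : EuclideanSpace ℝ (Fin n)) :
    Integrable (fun x => Real.exp (-(1 / (4 * b)) * ‖y - x‖ ^ 2)) μ := by
  refine Integrable.of_bound (Continuous.aestronglyMeasurable (by fun_prop)) 1
    (Filter.Eventually.of_forall fun x => ?_)
  rw [Real.norm_eq_abs, abs_of_pos (Real.exp_pos _), Real.exp_le_one_iff, neg_mul,
    Left.neg_nonpos_iff]
  positivity

lemma integrable_expMoment (m : ℕ) {s : ℝ} (hs : 0 < s) (y : EuclideanSpace ℝ (Fin n)) :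
    Integrable (fun x => expWeight (y - x) ^ m * heatKernelN 0 s (y - x)) μ := by
  obtain ⟨C, hC, h⟩ := expWeight_pow_mul_heatKernelN_le (n := n) hs s m
  refine ((integrable_gaussEnvelope_section hs y).const_mul C).mono'
    (Continuous.aestronglyMeasurable ?_) (Filter.Eventually.of_forall fun x => ?_)
  · exact ((continuous_expWeight.comp (by fun_prop)).pow m).mul
      ((continuous_heatKernelN 0 s).comp (by fun_prop))
  · rw [Real.norm_eq_abs, abs_of_nonneg]
    · exact h s ⟨le_rfl, le_rfl⟩ _
    · have := one_le_expWeight (y - x)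
      have := heatKernelN_zero_pos hs (y - x)
      positivity

lemma expMoment_le_gaussEnvelope {a b : ℝ} (ha : 0 < a) (hab : a ≤ b) (m : ℕ) :
    ∃ C, 0 ≤ C ∧ ∀ s ∈ Set.Icc a b, ∀ y, expMoment μ m s y ≤ C * gaussEnvelope μ b y := by
  obtain ⟨C, hC, h⟩ := expWeight_pow_mul_heatKernelN_le (n := n) ha b m
  refine ⟨C, hC, fun s hs y => ?_⟩
  rw [expMoment, gaussEnvelope, ← integral_const_mul]
  exact integral_mono (integrable_expMoment m (ha.trans_le hs.1) y)
    ((integrable_gaussEnvelope_section (ha.trans_le hab) y).const_mul C) fun x => h s hs _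

lemma integrable_gaussEnvelope {b : ℝ} (hb : 0 < b) : Integrable (gaussEnvelope μ b) volume := by
  set c := 1 / (4 * b)
  have hc : 0 < c := by positivity
  have hg : Integrable (fun z : EuclideanSpace ℝ (Fin n) => Real.exp (-c * ‖z‖ ^ 2)) volume := by
    by_contra hcon
    have h1 := GaussianFourier.integral_rexp_neg_mul_sq_norm (V := EuclideanSpace ℝ (Fin n)) hc
    rw [integral_undef hcon] at h1
    have : 0 < (π / c) ^ ((Module.finrank ℝ (EuclideanSpace ℝ (Fin n)) : ℝ) / 2) := by positivity
    linarith
  have hprod : Integrable (fun q : EuclideanSpace ℝ (Fin n) × EuclideanSpace ℝ (Fin n) =>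
      Real.exp (-c * ‖q.2 - q.1‖ ^ 2)) (μ.prod volume) := by
    rw [integrable_prod_iff (Continuous.aestronglyMeasurable (by fun_prop))]
    refine ⟨Filter.Eventually.of_forall fun x => hg.comp_sub_right x, ?_⟩
    simp only [Real.norm_eq_abs, abs_of_pos (Real.exp_pos _)]
    simp only [integral_sub_right_eq_self
      (fun z : EuclideanSpace ℝ (Fin n) => Real.exp (-c * ‖z‖ ^ 2))]
    exact integrable_const _
  exact hprod.integral_prod_right

lemma expMoment_zero (μ : Measure (EuclideanSpace ℝ (Fin n))) (s : ℝ) (y : EuclideanSpace ℝ (Fin n)) :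
    expMoment μ 0 s y = heatMoment μ 1 0 s y := by
  simp [expMoment, heatMoment]

lemma expMoment_mono {k m : ℕ} (hkm : k ≤ m) {s : ℝ} (hs : 0 < s)
    (y : EuclideanSpace ℝ (Fin n)) : expMoment μ k s y ≤ expMoment μ m s y := by
  refine integral_mono (integrable_expMoment k hs y) (integrable_expMoment m hs y) fun x => ?_
  have := one_le_expWeight (y - x)
  have := heatKernelN_zero_pos hs (y - x)
  dsimp only
  gcongr

lemma expMoment_sq_le (m : ℕ) {s : ℝ} (hs : 0 < s) (y : EuclideanSpace ℝ (Fin n)) :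
    expMoment μ m s y ^ 2 ≤ expMoment μ (2 * m) s y * heatMoment μ 1 0 s y := by
  set A := expMoment μ m s y
  set R := heatMoment μ 1 0 s y
  have hR : 0 < R := heatMoment_one_zero_pos hs y
  have hi := fun m => integrable_expMoment (μ := μ) m hs y
  have h0 : ∫ x, (2 * (A / R)) * (expWeight (y - x) ^ m * heatKernelN 0 s (y - x)) ∂μ ≤
      ∫ x, (expWeight (y - x) ^ (2 * m) * heatKernelN 0 s (y - x)
        + (A / R) ^ 2 * (expWeight (y - x) ^ 0 * heatKernelN 0 s (y - x))) ∂μ := by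
    refine integral_mono ((hi _).const_mul _) ((hi _).add ((hi _).const_mul _)) fun x => ?_
    have h1 := (heatKernelN_zero_pos hs (y - x)).le
    have : 0 ≤ (expWeight (y - x) ^ m - A / R) ^ 2 * heatKernelN 0 s (y - x) := by positivity
    dsimp only
    rw [pow_mul', pow_zero]
    linarith
  rw [integral_add (hi _) ((hi _).const_mul _), integral_const_mul, integral_const_mul] at h0
  change 2 * (A / R) * A ≤ expMoment μ (2 * m) s y + (A / R) ^ 2 * expMoment μ 0 s y at h0
  rw [expMoment_zero] at h0
  change 2 * (A / R) * A ≤ expMoment μ (2 * m) s y + (A / R) ^ 2 * R at h0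
  have e : (A / R) ^ 2 * R = A ^ 2 / R := by field_simp
  have e2 : 2 * (A / R) * A = 2 * (A ^ 2 / R) := by ring
  rw [← div_le_iff₀ hR]
  linarith

lemma abs_heatMoment_le_expMoment (hM : ∀ x, |w x| ≤ M) {a : ℝ} (ha : 0 < a)
    (α : Fin n → ℕ) : ∃ C m, 0 ≤ C ∧ ∀ s, a ≤ s → ∀ y,
      |heatMoment μ w α s y| ≤ C * expMoment μ (m : ℕ) s y := by
  obtain ⟨C, m, hC, h⟩ := abs_heatKernelN_le ha α
  have hM0 : 0 ≤ M := (abs_nonneg _).trans (hM 0)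
  refine ⟨M * C, m, by positivity, fun s hs y => ?_⟩
  rw [heatMoment, expMoment, ← integral_const_mul, ← Real.norm_eq_abs]
  refine norm_integral_le_of_norm_le ((integrable_expMoment m (ha.trans_le hs) y).const_mul _)
    (Filter.Eventually.of_forall fun x => ?_)
  rw [Real.norm_eq_abs, abs_mul, mul_assoc]
  gcongr
  · exact hM x
  · exact h s hs _

end Moment

end HeatMoment

section Algebra

variable {n : ℕ}

/-- Formal polynomials in the normalized moments `∫ w(x) ∂^α γ_s(y - x) dμ(x) / ρ_s(y)`, where
`w` is `f` (first index `true`) or `1` (first index `false`). -/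
abbrev MomentAlg (n : ℕ) := MvPolynomial (Bool × (Fin n → ℕ)) ℝ

namespace MomentAlg

/-- The generator standing for `∂^α (f_s ρ_s) / ρ_s`, respectively `∂^α ρ_s / ρ_s`. -/
abbrev gen (b : Bool) (α : Fin n → ℕ) : MomentAlg n := MvPolynomial.X (b, α)

/-- The formal space derivative in direction `i`. -/
def dx (i : Fin n) : Derivation ℝ (MomentAlg n) (MomentAlg n) :=
  MvPolynomial.mkDerivation ℝ fun p =>
    gen p.1 (p.2 + Pi.single i 1) - gen p.1 p.2 * gen false (Pi.single i 1)

/-- The formal time derivative. -/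
def dt : Derivation ℝ (MomentAlg n) (MomentAlg n) :=
  MvPolynomial.mkDerivation ℝ fun p => MvPolynomial.C 2⁻¹ * ∑ j,
    (gen p.1 (p.2 + Pi.single j 1 + Pi.single j 1) -
      gen p.1 p.2 * gen false (Pi.single j 1 + Pi.single j 1))

@[simp] lemma dx_gen (i : Fin n) (b : Bool) (α : Fin n → ℕ) :
    dx i (gen b α) = gen b (α + Pi.single i 1) - gen b α * gen false (Pi.single i 1) :=
  MvPolynomial.mkDerivation_X _ _ _

@[simp] lemma dt_gen (b : Bool) (α : Fin n → ℕ) :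
    dt (gen b α) = MvPolynomial.C 2⁻¹ * ∑ j,
      (gen b (α + Pi.single j 1 + Pi.single j 1) -
        gen b α * gen false (Pi.single j 1 + Pi.single j 1)) :=
  MvPolynomial.mkDerivation_X _ _ _

/-- The weight `f` or `1`. -/
def weight (f : EuclideanSpace ℝ (Fin n) → ℝ) (b : Bool) : EuclideanSpace ℝ (Fin n) → ℝ :=
  if b then f else 1

/-- Evaluation of formal moment polynomials at time `s` and position `y`. -/
def ev (μ : Measure (EuclideanSpace ℝ (Fin n))) (f : EuclideanSpace ℝ (Fin n) → ℝ) (s : ℝ)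
    (y : EuclideanSpace ℝ (Fin n)) : MomentAlg n →ₐ[ℝ] ℝ :=
  MvPolynomial.aeval fun p => heatMoment μ (weight f p.1) p.2 s y / heatMoment μ 1 0 s y

lemma ev_gen (μ : Measure (EuclideanSpace ℝ (Fin n))) (f : EuclideanSpace ℝ (Fin n) → ℝ) (s : ℝ)
    (y : EuclideanSpace ℝ (Fin n)) (b : Bool) (α : Fin n → ℕ) :
    ev μ f s y (gen b α) = heatMoment μ (weight f b) α s y / heatMoment μ 1 0 s y :=
  MvPolynomial.aeval_X _ _

variable {μ : Measure (EuclideanSpace ℝ (Fin n))} [IsProbabilityMeasure μ]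
  {f : EuclideanSpace ℝ (Fin n) → ℝ} {M : ℝ}

lemma measurable_weight (hf : Measurable f) (b : Bool) : Measurable (weight f b) := by
  cases b
  · exact measurable_const
  · exact hf

lemma abs_weight_le (hM : ∀ x, |f x| ≤ M) (b : Bool) (x : EuclideanSpace ℝ (Fin n)) :
    |weight f b x| ≤ max M 1 := by
  cases b
  · simp [weight]
  · exact (hM x).trans (le_max_left _ _)

theorem hasFDerivAt_ev (hf : Measurable f) (hM : ∀ x, |f x| ≤ M) {s : ℝ} (hs : 0 < s)
    (P : MomentAlg n) (y : EuclideanSpace ℝ (Fin n)) :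
    HasFDerivAt (fun y => ev μ f s y P)
      (∑ i, ev μ f s y (dx i P) • (EuclideanSpace.proj i : EuclideanSpace ℝ (Fin n) →L[ℝ] ℝ))
      y := by
  induction P using MvPolynomial.induction_on with
  | C a =>
    have h : ∀ i : Fin n, dx i (MvPolynomial.C a) = 0 := fun i => (dx i).map_algebraMap a
    simp only [h, map_zero, zero_smul, Finset.sum_const_zero]
    have h' : ∀ y, ev μ f s y (MvPolynomial.C a) = a := fun y => (ev μ f s y).commutes a
    simp only [h']
    exact hasFDerivAt_const _ _
  | add p q hp hq =>
    simp only [map_add]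
    refine (hp.add hq).congr_fderiv ?_
    rw [← Finset.sum_add_distrib]
    simp only [add_smul]
  | mul_X p x hp =>
    obtain ⟨b, α⟩ := x
    have hρ := heatMoment_one_zero_pos (μ := μ) hs y
    have h1 := hasFDerivAt_heatMoment (μ := μ) (measurable_weight hf b) (abs_weight_le hM b) α hs y
    have h2 := hasFDerivAt_heatMoment (μ := μ) (measurable_weight hf false)
      (abs_weight_le hM false) 0 hs y
    have h3 := hp.mul (h1.mul ((hasDerivAt_inv hρ.ne').comp_hasFDerivAt y h2))
    simp only [map_mul, ev_gen, div_eq_mul_inv]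
    refine h3.congr_fderiv ?_
    ext v
    simp only [ev_gen, weight, Derivation.leibniz, dx_gen, map_add, map_sub, map_mul, smul_eq_mul]
    simp only [add_apply, smul_apply, sum_apply,
      smul_eq_mul, Finset.mul_sum,
      ← Finset.sum_add_distrib, zero_add]
    refine Finset.sum_congr rfl fun i _ => ?_
    have : weight (n := n) f false = 1 := rfl
    simp
    field_simp
    ring

theorem hasDerivAt_ev (hf : Measurable f) (hM : ∀ x, |f x| ≤ M) {s : ℝ} (hs : 0 < s)
    (P : MomentAlg n) (y : EuclideanSpace ℝ (Fin n)) :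
    HasDerivAt (fun s => ev μ f s y P) (ev μ f s y (dt P)) s := by
  induction P using MvPolynomial.induction_on with
  | C a =>
    have h : dt (n := n) (MvPolynomial.C a) = 0 := dt.map_algebraMap a
    have h' : ∀ s, ev μ f s y (MvPolynomial.C a) = a := fun s => (ev μ f s y).commutes a
    simp only [h', h, map_zero]
    exact hasDerivAt_const _ _
  | add p q hp hq =>
    simp only [map_add]
    exact hp.add hq
  | mul_X p x hp =>
    obtain ⟨b, α⟩ := x
    have hρ := heatMoment_one_zero_pos (μ := μ) hs y
    have h1 := hasDerivAt_heatMoment_time (μ := μ) (measurable_weight hf b) (abs_weight_le hM b)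
      α hs y
    have h2 := hasDerivAt_heatMoment_time (μ := μ) (measurable_weight hf false)
      (abs_weight_le hM false) 0 hs y
    have h3 := hp.mul (h1.div h2 hρ.ne')
    simp only [map_mul, ev_gen]
    refine h3.congr_deriv ?_
    have hC : ev μ f s y (MvPolynomial.C 2⁻¹) = 2⁻¹ := (ev μ f s y).commutes _
    have : weight (n := n) f false = 1 := rfl
    simp only [ev_gen, Derivation.leibniz, dt_gen, map_add, map_sub, map_mul, smul_eq_mul,
      map_sum, hC, zero_add, this, Finset.sum_sub_distrib, ← Finset.mul_sum, ← Finset.sum_div, Pi.div_apply]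
    field_simp
    ring

end MomentAlg

end Algebra

section Mean

variable {n : ℕ}

namespace MomentAlg

variable {μ : Measure (EuclideanSpace ℝ (Fin n))} [IsProbabilityMeasure μ]
  {f : EuclideanSpace ℝ (Fin n) → ℝ} {M : ℝ}

lemma density_mul_abs_ev_le_expMoment (hM : ∀ x, |f x| ≤ M) {a : ℝ} (ha : 0 < a)
    (P : MomentAlg n) : ∃ C m, 0 ≤ C ∧ ∀ s, a ≤ s → ∀ y,
      heatMoment μ 1 0 s y * |ev μ f s y P| ≤ C * expMoment μ (m : ℕ) s y := by
  induction P using MvPolynomial.induction_on with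
  | C c =>
    refine ⟨|c|, 0, abs_nonneg c, fun s _ y => ?_⟩
    have h : ev μ f s y (MvPolynomial.C c) = c := (ev μ f s y).commutes c
    rw [h, expMoment_zero, mul_comm]
  | add p q hp hq =>
    obtain ⟨C, k, hC, hp⟩ := hp
    obtain ⟨D, m, hD, hq⟩ := hq
    refine ⟨C + D, max k m, by positivity, fun s hs y => ?_⟩
    have hs' := ha.trans_le hs
    rw [map_add, add_mul]
    calc _ ≤ heatMoment μ 1 0 s y * (|ev μ f s y p| + |ev μ f s y q|) :=
          mul_le_mul_of_nonneg_left (abs_add_le _ _) (heatMoment_one_zero_pos hs' y).le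
      _ = _ := mul_add _ _ _
      _ ≤ _ := add_le_add ((hp s hs y).trans (mul_le_mul_of_nonneg_left
          (expMoment_mono (le_max_left _ _) hs' y) hC)) ((hq s hs y).trans
          (mul_le_mul_of_nonneg_left (expMoment_mono (le_max_right _ _) hs' y) hD))
  | mul_X p x hp =>
    obtain ⟨C, k, hC, hp⟩ := hp
    obtain ⟨D, m, hD, hq⟩ := abs_heatMoment_le_expMoment (μ := μ) (abs_weight_le hM x.1) ha x.2
    refine ⟨C * D, 2 * max k m, by positivity, fun s hs y => ?_⟩
    have hs' := ha.trans_le hs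
    have hρ := heatMoment_one_zero_pos (μ := μ) hs' y
    have h1 := (hp s hs y).trans (mul_le_mul_of_nonneg_left
      (expMoment_mono (μ := μ) (le_max_left k m) hs' y) hC)
    have h2 := (hq s hs y).trans (mul_le_mul_of_nonneg_left
      (expMoment_mono (μ := μ) (le_max_right k m) hs' y) hD)
    have h3 := mul_le_mul h1 h2 (abs_nonneg _) ((mul_nonneg hρ.le (abs_nonneg _)).trans h1)
    have h4 := expMoment_sq_le (μ := μ) (max k m) hs' y
    have h5 := mul_le_mul_of_nonneg_left h4 (mul_nonneg hC hD)
    rw [map_mul, abs_mul, ev_gen μ f s y x.1 x.2, abs_div, abs_of_pos hρ]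
    refine le_of_mul_le_mul_right ?_ hρ
    calc _ = heatMoment μ 1 0 s y * |ev μ f s y p| * |heatMoment μ (weight f x.1) x.2 s y| := by
          field_simp
      _ ≤ _ := by linarith

lemma abs_density_mul_ev_le_gaussEnvelope (hM : ∀ x, |f x| ≤ M) {a b : ℝ} (ha : 0 < a)
    (hab : a ≤ b) (P : MomentAlg n) : ∃ C, 0 ≤ C ∧ ∀ s ∈ Set.Icc a b, ∀ y,
      |heatMoment μ 1 0 s y * ev μ f s y P| ≤ C * gaussEnvelope μ b y := by
  obtain ⟨C, m, hC, h1⟩ := density_mul_abs_ev_le_expMoment (μ := μ) hM ha P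
  obtain ⟨D, hD, h2⟩ := expMoment_le_gaussEnvelope (μ := μ) ha hab m
  refine ⟨C * D, by positivity, fun s hs y => ?_⟩
  rw [abs_mul, abs_of_pos (heatMoment_one_zero_pos (ha.trans_le hs.1) y), mul_assoc]
  exact (h1 s hs.1 y).trans (mul_le_mul_of_nonneg_left (h2 s hs y) hC)

lemma hasFDerivAt_density {s : ℝ} (hs : 0 < s) (y : EuclideanSpace ℝ (Fin n)) :
    HasFDerivAt (heatMoment μ 1 0 s) (∑ i, heatMoment μ 1 (Pi.single i 1) s y •
      (EuclideanSpace.proj i : EuclideanSpace ℝ (Fin n) →L[ℝ] ℝ)) y := by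
  simpa using hasFDerivAt_heatMoment (μ := μ) (w := 1) (M := 1) measurable_const (by simp) 0 hs y

lemma continuous_density {s : ℝ} (hs : 0 < s) : Continuous (heatMoment μ 1 0 s) :=
  continuous_iff_continuousAt.2 fun y => (hasFDerivAt_density hs y).continuousAt

lemma continuous_ev (hf : Measurable f) (hM : ∀ x, |f x| ≤ M) {s : ℝ} (hs : 0 < s)
    (P : MomentAlg n) : Continuous fun y => ev μ f s y P :=
  continuous_iff_continuousAt.2 fun y => (hasFDerivAt_ev hf hM hs P y).continuousAt

lemma integrable_density_mul_ev (hf : Measurable f) (hM : ∀ x, |f x| ≤ M) {s : ℝ} (hs : 0 < s)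
    (P : MomentAlg n) : Integrable fun y => heatMoment μ 1 0 s y * ev μ f s y P := by
  obtain ⟨C, _, h⟩ := abs_density_mul_ev_le_gaussEnvelope (μ := μ) hM hs le_rfl P
  exact ((integrable_gaussEnvelope hs).const_mul C).mono'
    ((continuous_density hs).mul (continuous_ev hf hM hs P)).aestronglyMeasurable
    (Filter.Eventually.of_forall fun y => h s ⟨le_rfl, le_rfl⟩ y)

/-- Expectation of a formal moment polynomial under the law at time `s`. -/
def mean (μ : Measure (EuclideanSpace ℝ (Fin n))) [IsProbabilityMeasure μ]
    {f : EuclideanSpace ℝ (Fin n) → ℝ} {M : ℝ} (hf : Measurable f) (hM : ∀ x, |f x| ≤ M) {s : ℝ}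
    (hs : 0 < s) : MomentAlg n →ₗ[ℝ] ℝ where
  toFun P := ∫ y, heatMoment μ 1 0 s y * ev μ f s y P
  map_add' P Q := by
    simp only [map_add, mul_add]
    exact integral_add (integrable_density_mul_ev hf hM hs P) (integrable_density_mul_ev hf hM hs Q)
  map_smul' c P := by
    simp only [map_smul, smul_eq_mul, RingHom.id_apply, ← integral_const_mul]
    exact integral_congr_ae (Filter.Eventually.of_forall fun y => by ring)

lemma mean_apply (hf : Measurable f) (hM : ∀ x, |f x| ≤ M) {s : ℝ} (hs : 0 < s)
    (P : MomentAlg n) : mean μ hf hM hs P = ∫ y, heatMoment μ 1 0 s y * ev μ f s y P := rfl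

lemma mean_mono (hf : Measurable f) (hM : ∀ x, |f x| ≤ M) {s : ℝ} (hs : 0 < s)
    {P Q : MomentAlg n} (h : ∀ y, ev μ f s y P ≤ ev μ f s y Q) :
    mean μ hf hM hs P ≤ mean μ hf hM hs Q :=
  integral_mono (integrable_density_mul_ev hf hM hs P) (integrable_density_mul_ev hf hM hs Q)
    fun y => mul_le_mul_of_nonneg_left (h y) (heatMoment_one_zero_pos hs y).le

/-- The formal adjoint derivative `(∂ᵢ + ∂ᵢ log ρ) P = ∂ᵢ (ρ P) / ρ`. -/
def weightedDx (i : Fin n) (P : MomentAlg n) : MomentAlg n :=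
  dx i P + gen false (Pi.single i 1) * P

/-- The formal operator `∂ₛ (ρ P) / ρ`. -/
def dtDensity (P : MomentAlg n) : MomentAlg n :=
  dt P + MvPolynomial.C 2⁻¹ * (∑ j, gen false (Pi.single j 1 + Pi.single j 1)) * P

theorem mean_weightedDx (hf : Measurable f) (hM : ∀ x, |f x| ≤ M) {s : ℝ} (hs : 0 < s)
    (i : Fin n) (P : MomentAlg n) : mean μ hf hM hs (weightedDx i P) = 0 := by
  let ρ' : EuclideanSpace ℝ (Fin n) → (EuclideanSpace ℝ (Fin n) →L[ℝ] ℝ) := fun y =>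
    ∑ i, heatMoment μ 1 (Pi.single i 1) s y • EuclideanSpace.proj i
  let P' : EuclideanSpace ℝ (Fin n) → (EuclideanSpace ℝ (Fin n) →L[ℝ] ℝ) := fun y =>
    ∑ i, ev μ f s y (dx i P) • EuclideanSpace.proj i
  have h1 : ∀ y, P' y (EuclideanSpace.single i 1) = ev μ f s y (dx i P) := fun y => by
    simp [P']
  have h2 : ∀ y, ρ' y (EuclideanSpace.single i 1) * ev μ f s y P =
      heatMoment μ 1 0 s y * ev μ f s y (gen false (Pi.single i 1) * P) := fun y => by
    have hρ := heatMoment_one_zero_pos (μ := μ) hs y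
    rw [map_mul, ev_gen]
    simp [ρ', weight]
    field_simp
  have h := integral_bilinear_hasFDerivAt_right_eq_neg_left_of_integrable
    (μ := volume) (f := heatMoment μ 1 0 s) (f' := ρ') (g := fun y => ev μ f s y P) (g' := P')
    (v := EuclideanSpace.single i 1) (B := ContinuousLinearMap.mul ℝ ℝ)
    (by simpa only [ContinuousLinearMap.mul_apply', h2] using
      integrable_density_mul_ev hf hM hs (gen false (Pi.single i 1) * P))
    (by simpa only [ContinuousLinearMap.mul_apply', h1] using
      integrable_density_mul_ev hf hM hs (dx i P))
    (integrable_density_mul_ev hf hM hs P)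
    (fun y _ => hasFDerivAt_density hs y) (fun y _ => hasFDerivAt_ev hf hM hs P y)
  simp only [ContinuousLinearMap.mul_apply', h1, h2] at h
  rw [weightedDx, map_add, mean_apply, mean_apply, h, neg_add_cancel]

theorem hasDerivAt_mean (hf : Measurable f) (hM : ∀ x, |f x| ≤ M) {s : ℝ} (hs : 0 < s)
    (P : MomentAlg n) :
    HasDerivAt (fun s => ∫ y, heatMoment μ 1 0 s y * ev μ f s y P)
      (mean μ hf hM hs (dtDensity P)) s := by
  have hs2 : 0 < s / 2 := by positivity
  obtain ⟨C, -, hC⟩ := abs_density_mul_ev_le_gaussEnvelope (μ := μ) hM hs2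
    (by linarith : s / 2 ≤ 2 * s) (dtDensity P)
  have hderiv : ∀ y, ∀ s' ∈ Set.Icc (s / 2) (2 * s),
      HasDerivAt (fun s => heatMoment μ 1 0 s y * ev μ f s y P)
        (heatMoment μ 1 0 s' y * ev μ f s' y (dtDensity P)) s' := fun y s' hs' => by
    have hs0 := hs2.trans_le hs'.1
    have hρ := heatMoment_one_zero_pos (μ := μ) hs0 y
    have h1 := hasDerivAt_heatMoment_time (μ := μ) (w := 1) (M := 1) measurable_const (by simp)
      0 hs0 y
    refine (h1.mul (hasDerivAt_ev hf hM hs0 P y)).congr_deriv ?_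
    have hC : ev μ f s' y (MvPolynomial.C 2⁻¹) = 2⁻¹ := (ev μ f s' y).commutes _
    have : weight (n := n) f false = 1 := rfl
    simp only [dtDensity, map_add, map_mul, map_sum, hC, ev_gen, this, zero_add,
      ← Finset.mul_sum, ← Finset.sum_div]
    field_simp
    ring
  have hbound : ∀ y, ∀ s' ∈ Set.Icc (s / 2) (2 * s),
      ‖heatMoment μ 1 0 s' y * ev μ f s' y (dtDensity P)‖ ≤ C * gaussEnvelope μ (2 * s) y :=
    fun y s' hs' => hC s' hs' y
  exact (hasDerivAt_integral_of_dominated_loc_of_deriv_le (𝕜 := ℝ) (μ := volume)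
    (F := fun s y => heatMoment μ 1 0 s y * ev μ f s y P)
    (F' := fun s y => heatMoment μ 1 0 s y * ev μ f s y (dtDensity P))
    (bound := fun y => C * gaussEnvelope μ (2 * s) y)
    (Icc_mem_nhds (by linarith : s / 2 < s) (by linarith : s < 2 * s))
    (Filter.eventually_of_mem (Ioi_mem_nhds hs) fun s' hs' =>
      (integrable_density_mul_ev hf hM hs' P).aestronglyMeasurable)
    (integrable_density_mul_ev hf hM hs P)
    (integrable_density_mul_ev hf hM hs _).aestronglyMeasurable
    (Filter.Eventually.of_forall hbound) ((integrable_gaussEnvelope (by positivity)).const_mul C)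
    (Filter.Eventually.of_forall hderiv)).2

end MomentAlg

end Mean

section Identities

variable {n : ℕ}

namespace MomentAlg

lemma dx_comm (i j : Fin n) (P : MomentAlg n) : dx i (dx j P) = dx j (dx i P) := by
  have h : ⁅dx (n := n) i, dx j⁆ = 0 := by
    refine MvPolynomial.derivation_ext fun p => ?_
    have hp : (MvPolynomial.X p : MomentAlg n) = gen p.1 p.2 := rfl
    rw [hp, Derivation.commutator_apply]
    simp only [dx_gen, map_sub, Derivation.leibniz, smul_eq_mul, Derivation.zero_apply,
      add_right_comm p.2 (Pi.single i 1) (Pi.single j 1),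
      add_comm (Pi.single i 1 : Fin n → ℕ) (Pi.single j 1)]
    ring
  have h2 := congrArg (fun D : Derivation ℝ (MomentAlg n) (MomentAlg n) => D P) h
  simp only [Derivation.commutator_apply, Derivation.zero_apply] at h2
  exact sub_eq_zero.1 h2

/-- The formal gradient of the score, `∂ⱼ ∂ᵢ log ρ`. -/
def scoreHess (i j : Fin n) : MomentAlg n := dx j (gen false (Pi.single i 1))

lemma scoreHess_comm (i j : Fin n) : scoreHess (n := n) i j = scoreHess j i := by
  simp only [scoreHess, dx_gen, add_comm (Pi.single i 1 : Fin n → ℕ) (Pi.single j 1)]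
  ring

/-- The formal heat operator `∂ₛ - ½ Δ - ∇ log ρ · ∇`. -/
def heatOp (P : MomentAlg n) : MomentAlg n :=
  dt P - MvPolynomial.C 2⁻¹ * ∑ j, (dx j (dx j P) + 2 * gen false (Pi.single j 1) * dx j P)

lemma C_half_mul_two : (MvPolynomial.C 2⁻¹ : MomentAlg n) * 2 = 1 := by
  have : (2 : MomentAlg n) = MvPolynomial.C 2 := (map_ofNat _ 2).symm
  rw [this, ← map_mul]
  norm_num

lemma dtDensity_eq (P : MomentAlg n) :
    dtDensity P = MvPolynomial.C 2⁻¹ * (∑ j, weightedDx j (weightedDx j P)) + heatOp P := by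
  have h : ∀ j : Fin n, weightedDx j (weightedDx j P) = dx j (dx j P) +
      2 * gen false (Pi.single j 1) * dx j P + gen false (Pi.single j 1 + Pi.single j 1) * P := by
    intro j
    simp only [weightedDx, map_add, Derivation.leibniz, smul_eq_mul, dx_gen]
    ring
  simp only [dtDensity, heatOp, h, Finset.sum_add_distrib, ← Finset.sum_mul]
  ring

@[simp] lemma heatOp_gen (b : Bool) (α : Fin n → ℕ) : heatOp (gen b α) = 0 := by
  rw [heatOp, dt_gen, ← mul_sub, ← Finset.sum_sub_distrib, Finset.sum_eq_zero, mul_zero]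
  intro j _
  simp only [map_sub, Derivation.leibniz, smul_eq_mul, dx_gen]
  ring

lemma heatOp_sub (P Q : MomentAlg n) : heatOp (P - Q) = heatOp P - heatOp Q := by
  simp only [heatOp, map_sub, Finset.sum_add_distrib, Finset.mul_sum, mul_sub,
    Finset.sum_sub_distrib, mul_add]
  ring

lemma heatOp_mul (P Q : MomentAlg n) :
    heatOp (P * Q) = P * heatOp Q + Q * heatOp P - ∑ j, dx j P * dx j Q := by
  have h : ∀ j : Fin n, dx j (dx j (P * Q)) + 2 * gen false (Pi.single j 1) * dx j (P * Q) =
      P * (dx j (dx j Q) + 2 * gen false (Pi.single j 1) * dx j Q) +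
      Q * (dx j (dx j P) + 2 * gen false (Pi.single j 1) * dx j P) +
      2 * (dx j P * dx j Q) := by
    intro j
    simp only [map_add, Derivation.leibniz, smul_eq_mul]
    ring
  simp only [heatOp, h, Finset.sum_add_distrib, ← Finset.mul_sum]
  rw [dt.leibniz, smul_eq_mul, smul_eq_mul]
  linear_combination (-∑ j, dx j P * dx j Q) * C_half_mul_two (n := n)

/-- The formal conditional expectation `f_s`. -/
def condGen : MomentAlg n := gen true 0

lemma heatOp_condGen : heatOp (condGen (n := n)) = 0 := heatOp_gen _ _

lemma heatOp_condGen_sq :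
    heatOp (condGen (n := n) * condGen) = -∑ j, dx j condGen * dx j condGen := by
  rw [heatOp_mul, heatOp_condGen]
  ring

lemma heatOp_dx_condGen (i : Fin n) :
    heatOp (dx i condGen) = ∑ j, scoreHess i j * dx j condGen := by
  rw [condGen, dx_gen, heatOp_sub, heatOp_mul, heatOp_gen, heatOp_gen, heatOp_gen]
  simp only [scoreHess, mul_comm]
  ring

lemma heatOp_dx_condGen_sq (i : Fin n) :
    heatOp (dx i condGen * dx i condGen) =
      ∑ j, (2 * (scoreHess i j * dx i condGen * dx j condGen) -
        dx j (dx i condGen) * dx j (dx i condGen)) := by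
  rw [heatOp_mul, heatOp_dx_condGen, Finset.mul_sum, ← Finset.sum_add_distrib,
    ← Finset.sum_sub_distrib]
  exact Finset.sum_congr rfl fun j _ => by ring

/-- Bochner-type formula for the weighted Laplacian. -/
lemma weightedDx_dx_mul_weightedDx_dx (i j : Fin n) (P : MomentAlg n) :
    weightedDx i (dx i P) * weightedDx j (dx j P) =
      weightedDx i (dx i P * weightedDx j (dx j P)) - weightedDx j (dx i P * dx j (dx i P)) +
      dx j (dx i P) * dx j (dx i P) - scoreHess i j * dx i P * dx j P := by
  have h1 : dx i (dx j (dx j P)) = dx j (dx j (dx i P)) := by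
    rw [dx_comm i j, dx_comm i j]
  rw [scoreHess_comm]
  simp only [weightedDx, map_add, Derivation.leibniz, smul_eq_mul, h1, scoreHess, dx_comm i j P]
  ring

variable {μ : Measure (EuclideanSpace ℝ (Fin n))} [IsProbabilityMeasure μ]
  {f : EuclideanSpace ℝ (Fin n) → ℝ} {M : ℝ}

/-- The formal squared gradient of `f_s`. -/
def gradSq : MomentAlg n := ∑ i, dx i condGen * dx i condGen

/-- The formal weighted Laplacian of `f_s`. -/
def weightedLaplacian : MomentAlg n := ∑ i, weightedDx i (dx i condGen)

lemma mean_dtDensity (hf : Measurable f) (hM : ∀ x, |f x| ≤ M) {s : ℝ} (hs : 0 < s)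
    (P : MomentAlg n) : mean μ hf hM hs (dtDensity P) = mean μ hf hM hs (heatOp P) := by
  rw [dtDensity_eq, map_add, ← MvPolynomial.smul_eq_C_mul, map_smul, map_sum]
  simp [mean_weightedDx]

lemma mean_dtDensity_condGen (hf : Measurable f) (hM : ∀ x, |f x| ≤ M) {s : ℝ} (hs : 0 < s) :
    mean μ hf hM hs (dtDensity condGen) = 0 := by
  rw [mean_dtDensity, heatOp_condGen, map_zero]

lemma mean_dtDensity_condGen_sq (hf : Measurable f) (hM : ∀ x, |f x| ≤ M) {s : ℝ} (hs : 0 < s) :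
    mean μ hf hM hs (dtDensity (condGen * condGen)) = -mean μ hf hM hs gradSq := by
  rw [mean_dtDensity, heatOp_condGen_sq, map_neg, gradSq]

lemma mean_weightedLaplacian (hf : Measurable f) (hM : ∀ x, |f x| ≤ M) {s : ℝ} (hs : 0 < s) :
    mean μ hf hM hs weightedLaplacian = 0 := by
  simp [weightedLaplacian, mean_weightedDx]

lemma mean_condGen_mul_weightedLaplacian (hf : Measurable f) (hM : ∀ x, |f x| ≤ M) {s : ℝ}
    (hs : 0 < s) :
    mean μ hf hM hs (condGen * weightedLaplacian) = -mean μ hf hM hs gradSq := by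
  have h : condGen (n := n) * weightedLaplacian = (∑ i, weightedDx i (condGen * dx i condGen)) - gradSq := by
    rw [weightedLaplacian, gradSq, Finset.mul_sum, ← Finset.sum_sub_distrib]
    refine Finset.sum_congr rfl fun i _ => ?_
    simp only [weightedDx, Derivation.leibniz, smul_eq_mul]
    ring
  rw [h, map_sub, map_sum]
  simp [mean_weightedDx]

lemma mean_dtDensity_gradSq (hf : Measurable f) (hM : ∀ x, |f x| ≤ M) {s : ℝ} (hs : 0 < s) :
    mean μ hf hM hs (dtDensity gradSq) =
      mean μ hf hM hs (∑ i, ∑ j, scoreHess i j * dx i condGen * dx j condGen) -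
        mean μ hf hM hs (weightedLaplacian * weightedLaplacian) := by
  have h0 : heatOp (gradSq (n := n)) = ∑ i, heatOp (dx i condGen * dx i condGen) := by
    simp only [gradSq, heatOp, map_sum, Finset.sum_sub_distrib, ← Finset.mul_sum]
    congr 2
    rw [Finset.sum_comm]
    simp only [Finset.sum_add_distrib, Finset.mul_sum]
  have h1 : weightedLaplacian (n := n) * weightedLaplacian = ∑ i, ∑ j,
      weightedDx i (dx i condGen) * weightedDx j (dx j condGen) := by
    rw [weightedLaplacian, Finset.sum_mul_sum]
  rw [mean_dtDensity, h0, h1]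
  simp only [weightedDx_dx_mul_weightedDx_dx, heatOp_dx_condGen_sq, map_sum, map_add, map_sub, mean_weightedDx,
    ← Finset.sum_sub_distrib]
  refine Finset.sum_congr rfl fun i _ => Finset.sum_congr rfl fun j _ => ?_
  rw [two_mul, map_add]
  ring

end MomentAlg

end Identities

section LogConcavity

variable {n : ℕ}

lemma second_deriv_nonpos_of_isLocalMax {F F' : ℝ → ℝ} {c t : ℝ}
    (hF : ∀ t, HasDerivAt F (F' t) t) (hF' : HasDerivAt F' c t) (hmax : IsLocalMax F t) :
    c ≤ 0 := by
  by_contra! hc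
  have hd : deriv F = F' := funext fun t => (hF t).deriv
  have hmin : IsLocalMin F t := isLocalMin_of_deriv_deriv_pos (by rwa [hd, hF'.deriv])
    hmax.deriv_eq_zero (hF t).continuousAt
  have hconst : F =ᶠ[nhds t] fun _ => F t := by
    filter_upwards [hmax, hmin] with u h1 h2 using le_antisymm h1 h2
  have h0 := hconst.deriv.deriv_eq
  rw [hd, hF'.deriv] at h0
  simp at h0
  exact hc.ne' h0

lemma gaussDensity_mul_le_sq {s : ℝ} (hs : 0 < s) (x y : EuclideanSpace ℝ (Fin n)) :
    gaussDensity n s x * gaussDensity n s y ≤ gaussDensity n s ((2⁻¹ : ℝ) • (x + y)) ^ 2 := by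
  have h : ‖(2⁻¹ : ℝ) • (x + y)‖ ^ 2 * 2 ≤ ‖x‖ ^ 2 + ‖y‖ ^ 2 := by
    have := parallelogram_law_with_norm ℝ x y
    rw [norm_smul, mul_pow, Real.norm_of_nonneg (by norm_num)]
    nlinarith [sq_nonneg ‖x - y‖]
  unfold gaussDensity
  rw [mul_mul_mul_comm, mul_pow, ← Real.exp_add, ← Real.exp_nat_mul, sq]
  rw [← add_div, ← mul_div_assoc, ← sq]
  gcongr
  push_cast
  linarith

theorem density_mul_le_sq {μ : Measure (EuclideanSpace ℝ (Fin n))} [IsProbabilityMeasure μ]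
    (hμ : IsLogConcave μ) {s : ℝ} (hs : 0 < s) (y z : EuclideanSpace ℝ (Fin n)) :
    heatMoment μ 1 0 s y * heatMoment μ 1 0 s z ≤
      heatMoment μ 1 0 s ((2⁻¹ : ℝ) • (y + z)) ^ 2 := by
  obtain ⟨K, H, hK, hKc, hH, hμK⟩ := hμ
  set p : EuclideanSpace ℝ (Fin n) → ℝ≥0∞ :=
    fun x => Set.indicator K (fun y => ENNReal.ofReal (Real.exp (-H y))) x with hp
  have hpm : Measurable p := by
    classical
    have h1 : ContinuousOn (fun y => ENNReal.ofReal (Real.exp (-H y))) K :=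
      ENNReal.continuous_ofReal.comp_continuousOn
        (Real.continuous_exp.comp_continuousOn (hH.continuousOn hK).neg)
    change Measurable (K.indicator _)
    rw [← Set.piecewise_eq_indicator]
    exact h1.measurable_piecewise (g := 0) continuousOn_const hK.measurableSet
  have hγ : Continuous (gaussDensity n s) := by unfold gaussDensity; fun_prop
  have hγ0 : ∀ x, 0 < gaussDensity n s x := fun x => by unfold gaussDensity; positivity
  let F : EuclideanSpace ℝ (Fin n) → EuclideanSpace ℝ (Fin n) → ℝ≥0∞ :=
    fun y x => p x * ENNReal.ofReal (gaussDensity n s (y - x))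
  have hFm : ∀ y, Measurable (F y) := fun y =>
    hpm.mul (ENNReal.measurable_ofReal.comp (hγ.measurable.comp (measurable_const.sub measurable_id)))
  have hlint : ∀ y, ∫⁻ x, F y x = ENNReal.ofReal (heatMoment μ 1 0 s y) := fun y => by
    rw [← heatDensity_eq_heatMoment hs, heatDensity, ofReal_integral_eq_lintegral_ofReal
      (by simpa [gaussDensity_eq_heatKernelN hs] using
        integrable_heatMoment (μ := μ) (w := 1) (M := 1) measurable_const (by simp) 0 hs y)
      (Filter.Eventually.of_forall fun x => (hγ0 _).le), hμK,
      lintegral_withDensity_eq_lintegral_mul _ hpm (g := fun x => ENNReal.ofReal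
        (gaussDensity n s (y - x))) (ENNReal.measurable_ofReal.comp
        (hγ.measurable.comp (measurable_const.sub measurable_id)))]
    rfl
  have hpl := lintegral_euclidean_mul_lintegral_le_sq (hFm y) (hFm z)
    (hFm ((2⁻¹ : ℝ) • (y + z))) fun a b => by
      by_cases ha : a ∈ K
      swap
      · simp [F, hp, ha]
      by_cases hb : b ∈ K
      swap
      · simp [F, hp, hb]
      have hab : (2⁻¹ : ℝ) • (a + b) ∈ K := by
        rw [smul_add]
        exact hKc ha hb (by norm_num) (by norm_num) (by norm_num)
      have hHab := hH.2 ha hb (by norm_num : (0 : ℝ) ≤ 2⁻¹) (by norm_num : (0 : ℝ) ≤ 2⁻¹)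
        (by norm_num)
      rw [← smul_add, smul_eq_mul, smul_eq_mul] at hHab
      simp only [F, hp, Set.indicator_of_mem ha, Set.indicator_of_mem hb, Set.indicator_of_mem hab]
      rw [← ENNReal.ofReal_mul (Real.exp_pos _).le, ← ENNReal.ofReal_mul (Real.exp_pos _).le,
        ← ENNReal.ofReal_mul (Real.exp_pos _).le,
        ← ENNReal.ofReal_mul (mul_nonneg (Real.exp_pos _).le (hγ0 _).le),
        ← ENNReal.ofReal_pow (mul_nonneg (Real.exp_pos _).le (hγ0 _).le)]
      refine ENNReal.ofReal_le_ofReal ?_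
      rw [mul_mul_mul_comm, mul_pow, ← Real.exp_add, ← Real.exp_nat_mul]
      have := gaussDensity_mul_le_sq hs (y - a) (z - b)
      rw [show y - a + (z - b) = (y + z) - (a + b) by abel, smul_sub] at this
      have h0 := mul_nonneg (hγ0 (y - a)).le (hγ0 (z - b)).le
      gcongr
      push_cast
      linarith
  have hpos := fun y => heatMoment_one_zero_pos (μ := μ) hs y
  rw [hlint, hlint, hlint, ← ENNReal.ofReal_mul (hpos y).le, ← ENNReal.ofReal_pow (hpos _).le] at hpl
  exact (ENNReal.ofReal_le_ofReal_iff (by positivity)).1 hpl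

namespace MomentAlg

variable {μ : Measure (EuclideanSpace ℝ (Fin n))} [IsProbabilityMeasure μ]
  {f : EuclideanSpace ℝ (Fin n) → ℝ} {M : ℝ}

theorem scoreHess_nonpos (hμ : IsLogConcave μ) (hf : Measurable f) (hM : ∀ x, |f x| ≤ M) {s : ℝ}
    (hs : 0 < s) (y : EuclideanSpace ℝ (Fin n)) (v : Fin n → ℝ) :
    ∑ i, ∑ j, ev μ f s y (scoreHess i j) * v i * v j ≤ 0 := by
  have hpos := fun y => heatMoment_one_zero_pos (μ := μ) hs y
  let w : EuclideanSpace ℝ (Fin n) := WithLp.toLp 2 v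
  have hline : ∀ t : ℝ, HasDerivAt (fun t : ℝ => y + t • w) w t := fun t => by
    simpa using ((hasDerivAt_id t).smul_const w).const_add y
  let q : ℝ → ℝ := fun t => ∑ i, ev μ f s (y + t • w) (gen false (Pi.single i 1)) * v i
  have hp : ∀ t, HasDerivAt (fun t : ℝ => Real.log (heatMoment μ 1 0 s (y + t • w))) (q t) t := by
    intro t
    have h := ((hasFDerivAt_density (μ := μ) hs (y + t • w)).comp_hasDerivAt t (hline t)).log
      (hpos (y + t • w)).ne'
    refine h.congr_deriv ?_
    simp only [q, ev_gen, sum_apply, smul_apply, PiLp.proj_apply, smul_eq_mul,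
      Finset.sum_div]
    exact Finset.sum_congr rfl fun i _ => div_mul_eq_mul_div _ _ _ |>.symm
  have hq : HasDerivAt q (∑ i, ∑ j, ev μ f s y (scoreHess i j) * v i * v j) 0 := by
    refine HasDerivAt.fun_sum fun i _ => ?_
    have hy : y = y + (0 : ℝ) • w := by simp
    have h := (((hy ▸ hasFDerivAt_ev (μ := μ) hf hM hs (gen false (Pi.single i 1)) y :
      HasFDerivAt _ _ (y + (0 : ℝ) • w))).comp_hasDerivAt (0 : ℝ) (hline 0)).mul_const (v i)
    refine h.congr_deriv ?_
    simp only [sum_apply, smul_apply, PiLp.proj_apply, smul_eq_mul, Finset.sum_mul]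
    exact Finset.sum_congr rfl fun j _ => by simp [scoreHess, w]; ring
  have hneg : ∀ t : ℝ, HasDerivAt (fun t : ℝ => -t) (-1) t := fun t => hasDerivAt_neg t
  have hF := fun t => (hp t).add ((hp (-t)).comp t (hneg t))
  have hF' := hq.add ((neg_zero (G := ℝ) ▸ hq : HasDerivAt q _ (-0)).comp (0 : ℝ) (hneg 0)).neg
  have h2 := second_deriv_nonpos_of_isLocalMax (t := 0)
    (fun t => (hF t).congr_deriv (by simp : _ = (q + -(q ∘ fun t => -t)) t)) hF'
    (Filter.Eventually.of_forall fun t => by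
      have h := density_mul_le_sq (μ := μ) hμ hs (y + t • w) (y + (-t) • w)
      have e : (2⁻¹ : ℝ) • ((y + t • w) + (y + (-t) • w)) = y := by
        rw [neg_smul, show (y + t • w) + (y + -(t • w)) = (2 : ℝ) • y by rw [two_smul]; abel,
          smul_smul]
        norm_num
      rw [e] at h
      have h3 := Real.log_le_log (mul_pos (hpos _) (hpos _)) h
      rw [Real.log_mul (hpos _).ne' (hpos _).ne', Real.log_pow] at h3
      push_cast at h3
      simpa [two_mul] using h3)
  linarith

lemma ev_scoreHess_grad_nonpos (hμ : IsLogConcave μ) (hf : Measurable f) (hM : ∀ x, |f x| ≤ M)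
    {s : ℝ} (hs : 0 < s) (y : EuclideanSpace ℝ (Fin n)) :
    ev μ f s y (∑ i, ∑ j, scoreHess i j * dx i condGen * dx j condGen) ≤ 0 := by
  simpa using scoreHess_nonpos hμ hf hM hs y fun i => ev μ f s y (dx i condGen)

end MomentAlg

end LogConcavity

section Law

variable {n : ℕ}

@[fun_prop]
lemma measurable_gaussDensity (s : ℝ) : Measurable (gaussDensity n s) := by
  unfold gaussDensity; fun_prop

lemma isProbabilityMeasure_stdGaussian (n : ℕ) : IsProbabilityMeasure (stdGaussian n) := by
  refine ⟨?_⟩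
  have hπ : (0 : ℝ) < 2 * π := by positivity
  have h1 : ∫ v : EuclideanSpace ℝ (Fin n), Real.exp (-‖v‖ ^ 2 / 2) = (2 * π) ^ ((n : ℝ) / 2) := by
    have h := GaussianFourier.integral_rexp_neg_mul_sq_norm (V := EuclideanSpace ℝ (Fin n))
      (by norm_num : (0 : ℝ) < 1 / 2)
    rw [finrank_euclideanSpace_fin, show π / (1 / 2) = 2 * π by ring] at h
    rw [← h]
    exact integral_congr_ae (Filter.Eventually.of_forall fun v => by ring_nf)
  have hint : Integrable fun v : EuclideanSpace ℝ (Fin n) => Real.exp (-‖v‖ ^ 2 / 2) := by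
    by_contra hcon
    rw [integral_undef hcon] at h1
    exact (Real.rpow_pos_of_pos hπ _).ne h1
  rw [_root_.stdGaussian, withDensity_apply _ MeasurableSet.univ, Measure.restrict_univ,
    ← ofReal_integral_eq_lintegral_ofReal (hint.const_mul _)
      (Filter.Eventually.of_forall fun v => by positivity), integral_const_mul, h1,
    ← Real.rpow_add hπ]
  simp [neg_div]

lemma lintegral_stdGaussian_comp_smul {s : ℝ} (hs : 0 < s)
    {g : EuclideanSpace ℝ (Fin n) → ℝ≥0∞} (hg : Measurable g) (x : EuclideanSpace ℝ (Fin n)) :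
    ∫⁻ z, g (x + √s • z) ∂stdGaussian n =
      ∫⁻ y, ENNReal.ofReal (gaussDensity n s (y - x)) * g y := by
  have hs' : √s ≠ 0 := (Real.sqrt_pos.2 hs).ne'
  have h0 : √s ^ n = s ^ ((n : ℝ) / 2) := by
    rw [Real.sqrt_eq_rpow, ← Real.rpow_natCast, ← Real.rpow_mul hs.le, one_div_mul_eq_div]
  have h1 : ∀ z : EuclideanSpace ℝ (Fin n),
      (2 * π) ^ (-(n : ℝ) / 2) * Real.exp (-‖z‖ ^ 2 / 2) =
        √s ^ n * gaussDensity n s (√s • z) := fun z => by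
    rw [gaussDensity, norm_smul, mul_pow, Real.norm_of_nonneg (Real.sqrt_nonneg s),
      Real.sq_sqrt hs.le, Real.mul_rpow (by positivity) hs.le, h0,
      ← mul_assoc, mul_left_comm, ← Real.rpow_add hs, neg_div, add_neg_cancel, Real.rpow_zero,
      mul_one, neg_div, neg_div, mul_comm 2 s,
      mul_div_mul_left _ _ hs.ne']
  have hmap : Measure.map (√s • ·) (volume : Measure (EuclideanSpace ℝ (Fin n))) =
      ENNReal.ofReal |(√s ^ n)⁻¹| • volume := by
    rw [Measure.map_addHaar_smul volume hs', finrank_euclideanSpace_fin]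
  have h2 : ∫⁻ z, ENNReal.ofReal (gaussDensity n s (√s • z)) * g (x + √s • z) =
      ENNReal.ofReal |(√s ^ n)⁻¹| * ∫⁻ y, ENNReal.ofReal (gaussDensity n s y) * g (x + y) := by
    rw [← smul_eq_mul, ← lintegral_smul_measure, ← hmap, lintegral_map (by fun_prop) (by fun_prop)]
  calc ∫⁻ z, g (x + √s • z) ∂stdGaussian n
      = ∫⁻ z, ENNReal.ofReal (√s ^ n) *
          (ENNReal.ofReal (gaussDensity n s (√s • z)) * g (x + √s • z)) := by
        rw [_root_.stdGaussian, lintegral_withDensity_eq_lintegral_mul _ (by fun_prop) (by fun_prop)]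
        refine lintegral_congr fun z => ?_
        rw [Pi.mul_apply, h1, ENNReal.ofReal_mul (by positivity), mul_assoc]
    _ = ∫⁻ y, ENNReal.ofReal (gaussDensity n s y) * g (x + y) := by
        rw [lintegral_const_mul' _ _ ENNReal.ofReal_ne_top, h2, ← mul_assoc,
          ← ENNReal.ofReal_mul (by positivity), abs_of_nonneg (by positivity),
          mul_inv_cancel₀ (pow_ne_zero _ hs'), ENNReal.ofReal_one, one_mul]
    _ = ∫⁻ y, ENNReal.ofReal (gaussDensity n s (y - x)) * g y := by
        rw [← lintegral_add_right_eq_self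
          (fun y => ENNReal.ofReal (gaussDensity n s (y - x)) * g y) x]
        simp [add_comm]

variable {μ : Measure (EuclideanSpace ℝ (Fin n))} [IsProbabilityMeasure μ]

lemma isProbabilityMeasure_heatFlow (s : ℝ) : IsProbabilityMeasure (heatFlow μ s) := by
  have := isProbabilityMeasure_stdGaussian n
  exact Measure.isProbabilityMeasure_map (by fun_prop)

lemma measurable_ofReal_density {s : ℝ} (hs : 0 < s) :
    Measurable fun y => ENNReal.ofReal (heatMoment μ 1 0 s y) :=
  ENNReal.measurable_ofReal.comp (MomentAlg.continuous_density hs).measurable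

theorem heatFlow_eq_withDensity {s : ℝ} (hs : 0 < s) :
    heatFlow μ s = volume.withDensity fun y => ENNReal.ofReal (heatMoment μ 1 0 s y) := by
  have := isProbabilityMeasure_stdGaussian n
  refine Measure.ext_of_lintegral _ fun g hg => ?_
  rw [heatFlow, lintegral_map hg (by fun_prop), lintegral_prod _ (by fun_prop),
    lintegral_withDensity_eq_lintegral_mul _ (measurable_ofReal_density hs) hg]
  simp only [lintegral_stdGaussian_comp_smul hs hg]
  rw [lintegral_lintegral_swap (Measurable.aemeasurable (by fun_prop))]
  refine lintegral_congr fun y => ?_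
  rw [lintegral_mul_const _ (by fun_prop), Pi.mul_apply, ← heatDensity_eq_heatMoment hs,
    heatDensity, ofReal_integral_eq_lintegral_ofReal]
  · simpa [gaussDensity_eq_heatKernelN hs] using
      integrable_heatMoment (μ := μ) (w := 1) (M := 1) measurable_const (by simp) 0 hs y
  · exact Filter.Eventually.of_forall fun x => by unfold gaussDensity; positivity

lemma integral_heatFlow {s : ℝ} (hs : 0 < s) (g : EuclideanSpace ℝ (Fin n) → ℝ) :
    ∫ y, g y ∂heatFlow μ s = ∫ y, heatMoment μ 1 0 s y * g y := by
  rw [heatFlow_eq_withDensity hs, integral_withDensity_eq_integral_toReal_smul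
    (measurable_ofReal_density hs)
    (Filter.Eventually.of_forall fun _ => ENNReal.ofReal_lt_top)]
  refine integral_congr_ae (Filter.Eventually.of_forall fun y => ?_)
  simp [ENNReal.toReal_ofReal (heatMoment_one_zero_pos hs y).le]

namespace MomentAlg

variable {f : EuclideanSpace ℝ (Fin n) → ℝ} {M : ℝ}

lemma mean_one (hf : Measurable f) (hM : ∀ x, |f x| ≤ M) {s : ℝ} (hs : 0 < s) :
    mean μ hf hM hs 1 = 1 := by
  have := isProbabilityMeasure_heatFlow (μ := μ) s
  have h := integral_heatFlow (μ := μ) hs fun _ => 1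
  simp only [mean_apply, map_one]
  rw [← h]
  simp

lemma condFn_eq_ev {μ : Measure (EuclideanSpace ℝ (Fin n))} {s : ℝ} (hs : 0 < s) (y : EuclideanSpace ℝ (Fin n)) :
    condFn μ f s y = ev μ f s y condGen := by
  rw [condFn, condGen, ev_gen, heatDensity_eq_heatMoment hs]
  congr 1
  refine integral_congr_ae (Filter.Eventually.of_forall fun x => ?_)
  simp only [← gaussDensity_eq_heatKernelN hs, weight, if_true]
  rw [mul_comm, gaussDensity, gaussDensity, norm_sub_rev]

lemma norm_fderiv_condFn_sq (hf : Measurable f) (hM : ∀ x, |f x| ≤ M) {s : ℝ} (hs : 0 < s)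
    (y : EuclideanSpace ℝ (Fin n)) :
    ‖fderiv ℝ (condFn μ f s) y‖ ^ 2 = ev μ f s y gradSq := by
  have h1 : condFn μ f s = fun y => ev μ f s y condGen := funext fun y => condFn_eq_ev hs y
  have h2 : ∀ c : Fin n → ℝ,
      ∑ i, c i • (EuclideanSpace.proj i : EuclideanSpace ℝ (Fin n) →L[ℝ] ℝ) =
        innerSL ℝ (WithLp.toLp 2 c) := fun c => by
    ext v
    simp [PiLp.inner_apply, mul_comm]
  rw [h1, (hasFDerivAt_ev hf hM hs condGen y).fderiv, h2, innerSL_apply_norm,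
    EuclideanSpace.real_norm_sq_eq]
  simp [gradSq, sq]

lemma integral_norm_fderiv_condFn_sq (hf : Measurable f) (hM : ∀ x, |f x| ≤ M) {s : ℝ}
    (hs : 0 < s) :
    ∫ y, ‖fderiv ℝ (condFn μ f s) y‖ ^ 2 ∂heatFlow μ s = mean μ hf hM hs gradSq := by
  rw [integral_heatFlow hs, mean_apply]
  simp only [norm_fderiv_condFn_sq hf hM hs]

lemma variance_condFn (hf : Measurable f) (hM : ∀ x, |f x| ≤ M) {s : ℝ} (hs : 0 < s) :
    variance (condFn μ f s) (heatFlow μ s) =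
      mean μ hf hM hs (condGen * condGen) - mean μ hf hM hs condGen ^ 2 := by
  have := isProbabilityMeasure_heatFlow (μ := μ) s
  have h1 : condFn μ f s = fun y => ev μ f s y condGen := funext fun y => condFn_eq_ev hs y
  have hmeas : AEStronglyMeasurable (condFn μ f s) (heatFlow μ s) := by
    rw [h1]; exact (continuous_ev hf hM hs _).aestronglyMeasurable
  have hL2 : MemLp (condFn μ f s) 2 (heatFlow μ s) := by
    rw [memLp_two_iff_integrable_sq hmeas, heatFlow_eq_withDensity hs,
      integrable_withDensity_iff_integrable_smul'
      (measurable_ofReal_density hs)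
      (Filter.Eventually.of_forall fun _ => ENNReal.ofReal_lt_top)]
    refine (integrable_density_mul_ev (μ := μ) hf hM hs (condGen * condGen)).congr
      (Filter.Eventually.of_forall fun y => ?_)
    simp [h1, ENNReal.toReal_ofReal (heatMoment_one_zero_pos hs y).le, sq]
  rw [variance_eq_sub hL2, integral_heatFlow hs, integral_heatFlow hs, mean_apply, mean_apply]
  simp [h1, sq]

end MomentAlg

end Law

section Rayleigh

variable {n : ℕ}

lemma antitoneOn_div_of_hasDerivAt {E V E' : ℝ → ℝ}
    (hV : ∀ s, 0 < s → HasDerivAt V (-E s) s) (hE : ∀ s, 0 < s → HasDerivAt E (E' s) s)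
    (hV0 : ∀ s, 0 < s → 0 ≤ V s) (hE0 : ∀ s, 0 < s → 0 ≤ E s)
    (h : ∀ s, 0 < s → E s ^ 2 ≤ V s * -E' s) :
    AntitoneOn (fun s => E s / V s) (Set.Ioi 0) := by
  have hVanti : AntitoneOn V (Set.Ioi 0) := by
    refine antitoneOn_of_deriv_nonpos (convex_Ioi 0)
      (fun s hs => (hV s hs).continuousAt.continuousWithinAt) (fun s hs => ?_) (fun s hs => ?_)
    · rw [interior_Ioi] at hs
      exact (hV s hs).differentiableAt.differentiableWithinAt
    · rw [interior_Ioi] at hs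
      rw [(hV s hs).deriv]
      exact neg_nonpos.2 (hE0 s hs)
  intro s hs t ht hst
  rcases (hV0 t ht).eq_or_lt with h0 | h0
  · simpa [← h0] using div_nonneg (hE0 s hs) (hV0 s hs)
  have hpos : ∀ r ∈ Set.Icc s t, 0 < r ∧ 0 < V r := fun r hr =>
    have hr0 : (0 : ℝ) < r := (show (0 : ℝ) < s from hs).trans_le hr.1
    ⟨hr0, h0.trans_le (hVanti hr0 ht hr.2)⟩
  have hd : ∀ r ∈ Set.Icc s t,
      HasDerivAt (fun s => E s / V s) ((E' r * V r - E r * -E r) / V r ^ 2) r := fun r hr =>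
    (hE r (hpos r hr).1).fun_div (hV r (hpos r hr).1) (hpos r hr).2.ne'
  refine antitoneOn_of_deriv_nonpos (convex_Icc s t)
    (fun r hr => (hd r hr).continuousAt.continuousWithinAt)
    (fun r hr => (hd r (interior_subset hr)).differentiableAt.differentiableWithinAt)
    (fun r hr => ?_) (Set.left_mem_Icc.2 hst) (Set.right_mem_Icc.2 hst) hst
  rw [(hd r (interior_subset hr)).deriv]
  refine div_nonpos_of_nonpos_of_nonneg ?_ (sq_nonneg _)
  linarith [h r (hpos r (interior_subset hr)).1]

namespace MomentAlg

variable {μ : Measure (EuclideanSpace ℝ (Fin n))} [IsProbabilityMeasure μ]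
  {f : EuclideanSpace ℝ (Fin n) → ℝ} {M : ℝ}

lemma mean_nonneg (hf : Measurable f) (hM : ∀ x, |f x| ≤ M) {s : ℝ} (hs : 0 < s)
    {P : MomentAlg n} (h : ∀ y, 0 ≤ ev μ f s y P) : 0 ≤ mean μ hf hM hs P := by
  simpa using mean_mono (μ := μ) hf hM hs (P := 0) (Q := P) (by simpa using h)

lemma mean_mul_self_nonneg (hf : Measurable f) (hM : ∀ x, |f x| ≤ M) {s : ℝ} (hs : 0 < s)
    (P : MomentAlg n) : 0 ≤ mean μ hf hM hs (P * P) :=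
  mean_nonneg hf hM hs fun y => by
    rw [map_mul]
    exact mul_self_nonneg _

lemma mean_mul_sq_le (hf : Measurable f) (hM : ∀ x, |f x| ≤ M) {s : ℝ} (hs : 0 < s)
    (P Q : MomentAlg n) :
    mean μ hf hM hs (P * Q) ^ 2 ≤ mean μ hf hM hs (P * P) * mean μ hf hM hs (Q * Q) := by
  have h : ∀ c : ℝ, 0 ≤ mean μ hf hM hs (Q * Q) * (c * c) +
      (2 * mean μ hf hM hs (P * Q)) * c + mean μ hf hM hs (P * P) := fun c => by
    have h1 : (P + c • Q) * (P + c • Q) =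
        (c * c) • (Q * Q) + (2 * c) • (P * Q) + P * P := by
      simp only [MvPolynomial.smul_eq_C_mul, map_mul, map_ofNat]
      ring
    have h2 := mean_mul_self_nonneg (μ := μ) hf hM hs (P + c • Q)
    rw [h1, map_add, map_add, map_smul, map_smul, smul_eq_mul, smul_eq_mul] at h2
    linarith
  have := discrim_le_zero h
  rw [discrim] at this
  linarith

lemma mean_condGen_sub (hf : Measurable f) (hM : ∀ x, |f x| ≤ M) {s : ℝ} (hs : 0 < s) :
    mean μ hf hM hs ((condGen - mean μ hf hM hs condGen • 1) *
      (condGen - mean μ hf hM hs condGen • 1)) =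
      mean μ hf hM hs (condGen * condGen) - mean μ hf hM hs condGen ^ 2 := by
  set m := mean μ hf hM hs condGen with hm
  have h : ((condGen : MomentAlg n) - m • 1) * (condGen - m • 1) =
      condGen * condGen - (2 * m) • condGen + (m * m) • 1 := by
    simp only [MvPolynomial.smul_eq_C_mul, map_mul, map_ofNat]
    ring
  rw [h, map_add, map_sub, map_smul, map_smul, mean_one, ← hm, smul_eq_mul, smul_eq_mul]
  ring

lemma mean_gradSq_sq_le (hf : Measurable f) (hM : ∀ x, |f x| ≤ M) {s : ℝ} (hs : 0 < s) :
    mean μ hf hM hs gradSq ^ 2 ≤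
      (mean μ hf hM hs (condGen * condGen) - mean μ hf hM hs condGen ^ 2) *
        mean μ hf hM hs (weightedLaplacian * weightedLaplacian) := by
  have h := mean_mul_sq_le (μ := μ) hf hM hs (condGen - mean μ hf hM hs condGen • 1)
    weightedLaplacian
  rwa [mean_condGen_sub, sub_mul, map_sub, mean_condGen_mul_weightedLaplacian, smul_mul_assoc,
    one_mul, map_smul, mean_weightedLaplacian, smul_zero, sub_zero, neg_sq] at h

theorem antitoneOn_rayleigh (hμ : IsLogConcave μ) (hf : Measurable f) (hM : ∀ x, |f x| ≤ M) :
    AntitoneOn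
      (fun s => (∫ y, ‖fderiv ℝ (condFn μ f s) y‖ ^ 2 ∂(heatFlow μ s)) /
        variance (condFn μ f s) (heatFlow μ s))
      (Set.Ioi (0 : ℝ)) := by
  let I : MomentAlg n → ℝ → ℝ := fun P s => ∫ y, heatMoment μ 1 0 s y * ev μ f s y P
  have hI : ∀ P s (hs : 0 < s), I P s = mean μ hf hM hs P := fun P s hs => rfl
  have hI' : ∀ P s (hs : 0 < s), HasDerivAt (I P) (I (dtDensity P) s) s := fun P s hs =>
    hasDerivAt_mean hf hM hs P
  have key : AntitoneOn
      (fun s => I gradSq s / (I (condGen * condGen) s - I condGen s ^ 2)) (Set.Ioi 0) := by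
    refine antitoneOn_div_of_hasDerivAt (V := fun s => I (condGen * condGen) s - I condGen s ^ 2)
      (E' := I (dtDensity gradSq)) (fun s hs => ?_) (fun s hs => hI' _ s hs)
      (fun s hs => ?_) (fun s hs => ?_) (fun s hs => ?_)
    · refine ((hI' _ s hs).fun_sub ((hI' _ s hs).fun_pow 2)).congr_deriv ?_
      rw [hI _ s hs, hI (dtDensity condGen) s hs, hI gradSq s hs, mean_dtDensity_condGen,
        mean_dtDensity_condGen_sq]
      ring
    · simp only [hI _ s hs]
      rw [← mean_condGen_sub]
      exact mean_mul_self_nonneg hf hM hs _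
    · rw [hI _ s hs]
      rw [gradSq, map_sum]
      exact Finset.sum_nonneg fun i _ => mean_mul_self_nonneg hf hM hs _
    · simp only [hI _ s hs]
      have hV : 0 ≤ mean μ hf hM hs (condGen * condGen) - mean μ hf hM hs condGen ^ 2 := by
        rw [← mean_condGen_sub]
        exact mean_mul_self_nonneg hf hM hs _
      refine (mean_gradSq_sq_le hf hM hs).trans (mul_le_mul_of_nonneg_left ?_ hV)
      have h := mean_mono (μ := μ) hf hM hs (Q := 0) fun y =>
        (ev_scoreHess_grad_nonpos hμ hf hM hs y).trans_eq (map_zero _).symm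
      rw [map_zero] at h
      rw [mean_dtDensity_gradSq]
      linarith
  refine key.congr fun s hs => ?_
  dsimp only
  rw [integral_norm_fderiv_condFn_sq hf hM hs, variance_condFn hf hM hs, hI _ s hs, hI _ s hs,
    hI _ s hs]

end MomentAlg

end Rayleigh

/-- For log-concave `μ` and smooth compactly supported nonconstant `f`,
the Rayleigh quotient `s ↦ E|∇f_s(X_s)|² / Var(f_s(X_s))` is non-increasing on `(0,∞)`. -/
theorem stmt18 {n : ℕ} (μ : Measure (EuclideanSpace ℝ (Fin n))) [IsProbabilityMeasure μ]
    (hμ : IsLogConcave μ)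
    (f : EuclideanSpace ℝ (Fin n) → ℝ) (hf : ContDiff ℝ (⊤ : ℕ∞) f)
    (hsupp : HasCompactSupport f) (hnc : ∃ x y, f x ≠ f y) :
    AntitoneOn
      (fun s => (∫ y, ‖fderiv ℝ (condFn μ f s) y‖ ^ 2 ∂(heatFlow μ s)) /
        variance (condFn μ f s) (heatFlow μ s))
      (Set.Ioi (0 : ℝ)) := by
  obtain ⟨M, hM⟩ := hsupp.exists_bound_of_continuous hf.continuous
  exact MomentAlg.antitoneOn_rayleigh hμ hf.continuous.measurable hM
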